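/- Let k ≥ 1 be an integer and let η ∈ ℚ₂ be such that for some sequence (k_j) of positive integers with k_j → ∞ (in ℝ) and ‖k_j + k‖₂ → 0, the rationals −(1 − 2^{2k_j − 1})·B_{2k_j}/(2k_j) converge to η in ℚ₂ (i.e. η = ζ₂(1+2k)). Set θ = (12·log 2)/(6·log 2 + 2k + 1). Then for every ε > 0 there exist sequences of integers (p_n), (q_n) with q_n ≠ 0 for all n and |q_n| → ∞, such that for all sufficiently large n: 0 < ‖η − p_n/q_n‖₂ ≤ (max(|p_n|, |q_n|))^{−(θ − ε)}. -/

import Mathlib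

namespace Zeta2

lemma dvd_choose_of_mod_lt {p n k : ℕ} (hp : p.Prime) (h : n % p < k % p) :
    p ∣ n.choose k := by
  have := Fact.mk hp
  have h' := Choose.choose_modEq_choose_mod_mul_choose_div_nat (n := n) (k := k) (p := p)
  rw [Nat.choose_eq_zero_of_lt h, zero_mul] at h'
  exact (Nat.modEq_zero_iff_dvd).1 h'

lemma mod_eq_of {a p q : ℕ} (h1 : q * p ≤ a) (h2 : a < (q + 1) * p) : a % p = a - q * p := by
  have : a = (a - q * p) + p * q := by rw [mul_comm p q]; omega
  rw [this, Nat.add_mul_mod_self_left, Nat.mod_eq_of_lt]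
  · rw [mul_comm p q]; omega
  · have : (q + 1) * p = q * p + p := by ring
    omega

lemma prime_dvd_multinomial {m p : ℕ} (hp : p.Prime) (h1 : m < p) (h2 : p ≤ 6 * m) :
    p ∣ (6 * m).choose (3 * m) * (3 * m).choose m := by
  rcases lt_or_ge (3 * m) p with h | h
  · apply Dvd.dvd.mul_right
    apply dvd_choose_of_mod_lt hp
    rw [mod_eq_of (q := 1) (by omega) (by omega), Nat.mod_eq_of_lt h]
    omega
  rcases lt_or_ge (2 * m) p with h' | h'
  · apply Dvd.dvd.mul_left
    apply dvd_choose_of_mod_lt hp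
    rw [mod_eq_of (q := 1) (by omega) (by omega), Nat.mod_eq_of_lt h1]
    omega
  rcases lt_or_ge (6 * m) (4 * p) with h3 | h3
  · apply Dvd.dvd.mul_right
    apply dvd_choose_of_mod_lt hp
    rw [mod_eq_of (q := 3) (by omega) (by omega), mod_eq_of (q := 1) (by omega) (by omega)]
    omega
  rcases lt_or_ge (6 * m) (5 * p) with h4 | h4
  · apply Dvd.dvd.mul_left
    apply dvd_choose_of_mod_lt hp
    rw [mod_eq_of (q := 2) (by omega) (by omega), Nat.mod_eq_of_lt h1]
    omega
  · apply Dvd.dvd.mul_right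
    apply dvd_choose_of_mod_lt hp
    rw [mod_eq_of (q := 5) (by omega) (by omega), mod_eq_of (q := 2) (by omega) (by omega)]
    omega

lemma choose_three_le (m : ℕ) : 4 ^ m * (3 * m).choose m ≤ 27 ^ m := by
  have h3 := add_pow (2 : ℕ) 1 (3 * m)
  simp only [Nat.cast_id] at h3
  have h4 : (2:ℕ) ^ (2 * m) * 1 ^ (3 * m - 2 * m) * (3 * m).choose (2 * m) ≤
      ∑ i ∈ Finset.range (3 * m + 1), (2:ℕ) ^ i * 1 ^ (3 * m - i) * (3 * m).choose i :=
    Finset.single_le_sum (f := fun i => (2:ℕ) ^ i * 1 ^ (3 * m - i) * (3 * m).choose i)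
      (fun _ _ => Nat.zero_le _) (by simp; omega)
  rw [← h3] at h4
  have h5 : (3 * m).choose (2 * m) = (3 * m).choose m := by
    rw [← Nat.choose_symm (by omega : m ≤ 3 * m)]; congr 1; omega
  rw [h5, pow_mul, pow_mul] at h4
  simpa using h4

lemma primorial_six (m : ℕ) : primorial (6 * m) ≤ 1728 ^ m := by
  have h := primorial_add m (5 * m)
  rw [show m + 5 * m = 6 * m by ring] at h
  have hd : (∏ p ∈ Finset.Ico (m + 1) (6 * m + 1) with p.Prime, p) ∣
      (6 * m).choose (3 * m) * (3 * m).choose m := by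
    apply Finset.prod_primes_dvd
    · intro p hp; exact (Finset.mem_filter.1 hp).2.prime
    · intro p hp
      obtain ⟨h1, h2⟩ := Finset.mem_filter.1 hp
      rw [Finset.mem_Ico] at h1
      exact prime_dvd_multinomial h2 (by omega) (by omega)
  have hpos : 0 < (6 * m).choose (3 * m) * (3 * m).choose m :=
    Nat.mul_pos (Nat.choose_pos (by omega)) (Nat.choose_pos (by omega))
  have h1 := Nat.le_of_dvd hpos hd
  have h2 : (6 * m).choose (3 * m) ≤ 64 ^ m := by
    have := Nat.choose_le_two_pow (6 * m) (3 * m)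
    rwa [pow_mul] at this
  have h3 := choose_three_le m
  have h4 := primorial_le_four_pow m
  calc primorial (6 * m) ≤ 4 ^ m * ((6 * m).choose (3 * m) * (3 * m).choose m) := by
        rw [h]; exact Nat.mul_le_mul h4 h1
    _ = (6 * m).choose (3 * m) * (4 ^ m * (3 * m).choose m) := by ring
    _ ≤ 64 ^ m * 27 ^ m := Nat.mul_le_mul h2 h3
    _ = 1728 ^ m := by rw [← mul_pow]; norm_num

lemma log_lcm_le (n : ℕ) (hn : 1 ≤ n) : Real.log (Nat.lcmUpto n) ≤
    (n / 6 + 1) * Real.log 1728 + 2 * Real.sqrt n * Real.log n := by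
  rw [← Chebyshev.psi_eq_log_lcmUpto]
  have h1 := Chebyshev.psi_sub_theta_le (x := n) (by exact_mod_cast hn)
  have h2 : Chebyshev.theta n ≤ (n / 6 + 1) * Real.log 1728 := by
    have h3 : Chebyshev.theta n ≤ Chebyshev.theta ((6 * (n / 6 + 1) : ℕ) : ℝ) :=
      Chebyshev.theta_mono (by exact_mod_cast (by omega))
    have h4 : Chebyshev.theta ((6 * (n / 6 + 1) : ℕ) : ℝ) ≤ ((n / 6 + 1 : ℕ) : ℝ) * Real.log 1728 := by
      rw [Chebyshev.theta_eq_log_primorial, Nat.floor_natCast, ← Real.log_pow]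
      apply Real.log_le_log
      · exact_mod_cast primorial_pos _
      · exact_mod_cast primorial_six _
    have h5 : ((n / 6 + 1 : ℕ) : ℝ) ≤ n / 6 + 1 := by
      push_cast
      have := @Nat.cast_div_le ℝ _ _ _ n 6
      push_cast at this; linarith
    have h6 : 0 ≤ Real.log 1728 := Real.log_nonneg (by norm_num)
    nlinarith
  linarith

lemma lcm_growth (C : ℝ) (c : ℕ) : ∀ᶠ n : ℕ in Filter.atTop,
    C * ((n : ℝ) + 1) ^ c * (Nat.lcmUpto n : ℝ) ^ 3 < 64 ^ n := by
  have hlog : ∀ δ : ℝ, 0 < δ → ∀ᶠ n : ℕ in Filter.atTop, Real.log n ≤ δ * Real.sqrt n := by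
    intro δ hδ
    have h := (isLittleO_log_rpow_atTop (r := 1/2) (by norm_num)).bound hδ
    have h' := tendsto_natCast_atTop_atTop (R := ℝ) |>.eventually h
    filter_upwards [h', Filter.eventually_ge_atTop 1] with n hn hn1
    rw [← Real.sqrt_eq_rpow, Real.norm_of_nonneg (Real.sqrt_nonneg _)] at hn
    exact (le_abs_self _).trans hn
  have e2 : Real.log 64 - Real.log 1728 / 2 > 0 := by
    have : Real.log 1728 < 2 * Real.log 64 := by
      rw [← Real.log_rpow (by norm_num)]
      apply Real.log_lt_log <;> norm_num
    linarith
  set g := Real.log 64 - Real.log 1728 / 2 with hg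
  set B := |C| + 1 with hB
  have hBpos : 0 < B := by positivity
  have hlarge : ∀ᶠ n : ℕ in Filter.atTop, Real.log B + c * Real.log 2 + 3 * Real.log 1728 < g / 4 * n := by
    have : Filter.Tendsto (fun n : ℕ => g / 4 * (n : ℝ)) Filter.atTop Filter.atTop :=
      Filter.Tendsto.const_mul_atTop (by positivity) tendsto_natCast_atTop_atTop
    exact this.eventually_gt_atTop _
  filter_upwards [hlog (g / 24) (by positivity), hlog (g / (4 * (c + 1))) (by positivity),
    hlarge, Filter.eventually_ge_atTop 1] with n h1 h2 h3 hn
  have hn' : (1:ℝ) ≤ n := by exact_mod_cast hn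
  have hL := log_lcm_le n hn
  have hs : Real.sqrt n * Real.sqrt n = n := Real.mul_self_sqrt (by positivity)
  have hs1 : Real.sqrt n ≤ n := by
    have : 1 ≤ Real.sqrt n := Real.one_le_sqrt.2 hn'
    nlinarith
  have hs0 := Real.sqrt_nonneg (n : ℝ)
  have hdpos : (0:ℝ) < Nat.lcmUpto n := by exact_mod_cast Nat.lcmUpto_pos n
  have hlt : B * ((n : ℝ) + 1) ^ c * (Nat.lcmUpto n : ℝ) ^ 3 < 64 ^ n := by
    rw [← Real.log_lt_log_iff (by positivity) (by positivity), Real.log_mul (by positivity) (by positivity),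
      Real.log_mul (by positivity) (by positivity), Real.log_pow, Real.log_pow, Real.log_pow]
    have h4 : Real.log ((n:ℝ) + 1) ≤ Real.log 2 + Real.log n := by
      rw [← Real.log_mul (by norm_num) (by positivity)]
      exact Real.log_le_log (by positivity) (by linarith)
    have h5 : c * Real.log n ≤ g / 4 * n := by
      have : (c:ℝ) * Real.log n ≤ (c + 1) * (g / (4 * (c + 1)) * Real.sqrt n) := by
        have : 0 ≤ Real.log n := Real.log_nonneg hn'
        have hc : (0:ℝ) ≤ c := by positivity
        nlinarith
      have e : ((c:ℝ) + 1) * (g / (4 * (c + 1)) * Real.sqrt n) = g / 4 * Real.sqrt n := by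
        field_simp
      rw [e] at this
      nlinarith
    have h6 : 2 * Real.sqrt n * Real.log n ≤ g / 12 * n := by
      have : Real.sqrt n * Real.log n ≤ Real.sqrt n * (g / 24 * Real.sqrt n) := by gcongr
      nlinarith
    have hc : (c:ℝ) * Real.log ((n:ℝ) + 1) ≤ c * (Real.log 2 + Real.log n) := by gcongr
    push_cast
    have : (n:ℝ) * Real.log 64 = n * g + n * (Real.log 1728 / 2) := by rw [hg]; ring
    have e2' : 0 < g * n := by positivity
    nlinarith
  refine lt_of_le_of_lt ?_ hlt
  have : C ≤ B := by rw [hB]; linarith [le_abs_self C]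
  gcongr

end Zeta2


namespace Zeta2

open Filter

/-- Arbitrarily large rational approximations of exponent `τ`. -/
def Good (η : ℚ_[2]) (τ : ℝ) : Prop :=
  ∀ X : ℕ, ∃ p q : ℤ, (X : ℤ) ≤ |q| ∧ q ≠ 0 ∧ 0 < ‖η - (p : ℚ_[2]) / (q : ℚ_[2])‖ ∧
    ‖η - (p : ℚ_[2]) / (q : ℚ_[2])‖ ≤ ((max |p| |q| : ℤ) : ℝ) ^ (-τ)

lemma nadd_le_max (a b : ℚ_[2]) : ‖a + b‖ ≤ max ‖a‖ ‖b‖ := IsUltrametricDist.norm_add_le_max a b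

lemma nsub_le_max (a b : ℚ_[2]) : ‖a - b‖ ≤ max ‖a‖ ‖b‖ := by
  simpa [sub_eq_add_neg] using nadd_le_max a (-b)

lemma nadd_le {a b : ℚ_[2]} {C : ℝ} (ha : ‖a‖ ≤ C) (hb : ‖b‖ ≤ C) : ‖a + b‖ ≤ C :=
  (nadd_le_max a b).trans (max_le ha hb)

lemma nsub_le {a b : ℚ_[2]} {C : ℝ} (ha : ‖a‖ ≤ C) (hb : ‖b‖ ≤ C) : ‖a - b‖ ≤ C :=
  (nsub_le_max a b).trans (max_le ha hb)

lemma nsum_le {ι : Type*} (s : Finset ι) (f : ι → ℚ_[2]) {C : ℝ} (hC : 0 ≤ C)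
    (h : ∀ i ∈ s, ‖f i‖ ≤ C) : ‖∑ i ∈ s, f i‖ ≤ C :=
  IsUltrametricDist.norm_sum_le_of_forall_le_of_nonneg hC h

lemma norm_two : ‖(2:ℚ_[2])‖ = 2⁻¹ := by simpa using Padic.norm_p (p := 2)

lemma norm_odd (z : ℤ) (h : z % 2 = 1) : ‖(z : ℚ_[2])‖ = 1 := by
  rw [Padic.norm_intCast_eq_one_iff]
  rw [Int.isCoprime_iff_gcd_eq_one]
  exact (Int.isCoprime_iff_gcd_eq_one.1 (Int.isCoprime_two_right.2 (Int.odd_iff.2 h)))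

lemma one_le_norm_mul_abs (z : ℤ) (h : z ≠ 0) : 1 ≤ ‖(z : ℚ_[2])‖ * |(z : ℝ)| := by
  obtain ⟨v, m, hm, rfl⟩ : ∃ v : ℕ, ∃ m : ℤ, m % 2 = 1 ∧ z = 2 ^ v * m := by
    obtain ⟨m, hm, hd⟩ := (Int.finiteMultiplicity_iff.2 ⟨by norm_num, h⟩ :
      FiniteMultiplicity 2 z).exists_eq_pow_mul_and_not_dvd
    exact ⟨_, m, by omega, hm⟩
  have hm0 : m ≠ 0 := by rintro rfl; simp at hm
  have h1 : (1:ℝ) ≤ |(m:ℝ)| := by exact_mod_cast Int.one_le_abs hm0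
  push_cast
  rw [norm_mul, norm_odd m hm, norm_pow, norm_two, abs_mul, abs_of_pos (by positivity : (0:ℝ) < 2 ^ v)]
  rw [inv_pow]
  field_simp
  exact h1

lemma Good.mono {η : ℚ_[2]} {τ σ : ℝ} (h : Good η τ) (hs : σ ≤ τ) : Good η σ := by
  intro X
  obtain ⟨p, q, h1, h2, h3, h4⟩ := h X
  refine ⟨p, q, h1, h2, h3, h4.trans ?_⟩
  apply Real.rpow_le_rpow_of_exponent_le
  · have : 1 ≤ |q| := Int.one_le_abs h2
    exact_mod_cast this.trans (le_max_right _ _)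
  · linarith

lemma Good.seq {η : ℚ_[2]} {τ : ℝ} (h : Good η τ) :
    ∃ P Q : ℕ → ℤ, (∀ n, Q n ≠ 0) ∧
      Filter.Tendsto (fun n => |Q n|) Filter.atTop Filter.atTop ∧
      ∀ᶠ n in Filter.atTop,
        0 < ‖η - (P n : ℚ_[2]) / (Q n : ℚ_[2])‖ ∧
        ‖η - (P n : ℚ_[2]) / (Q n : ℚ_[2])‖ ≤ ((max |P n| |Q n| : ℤ) : ℝ) ^ (-τ) := by
  choose P Q h1 h2 h3 h4 using h
  refine ⟨P, Q, h2, ?_, Eventually.of_forall fun n => ⟨h3 n, h4 n⟩⟩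
  exact tendsto_atTop_mono h1 tendsto_natCast_atTop_atTop

lemma rpow_compare {H D err : ℝ} {τ : ℝ} (hτ : 0 ≤ τ) (hH : 1 ≤ H) (hHD : H ≤ D)
    (h : err * D ^ τ ≤ 1) : err ≤ H ^ (-τ) := by
  have hD : 0 < D := by linarith
  have h1 : D ^ (-τ) ≤ H ^ (-τ) :=
    Real.rpow_le_rpow_of_nonpos (by linarith) hHD (by linarith)
  refine le_trans ?_ h1
  rw [Real.rpow_neg hD.le]
  have : 0 < D ^ τ := Real.rpow_pos_of_pos hD _
  rw [← one_div, le_div_iff₀ this]; exact h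

lemma good_rat (r : ℤ) (s : ℤ) (hs : s ≠ 0) (τ : ℝ) (hτ : τ < 1) :
    Good ((r : ℚ_[2]) / (s : ℚ_[2])) τ := by
  wlog h0 : 0 ≤ τ
  · exact (this r s hs 0 (by norm_num) le_rfl).mono (by linarith)
  intro X
  set S : ℝ := ‖(s : ℚ_[2])‖ with hS
  have hsq : (s : ℚ_[2]) ≠ 0 := by exact_mod_cast hs
  have hSpos : 0 < S := norm_pos_iff.2 hsq
  set C : ℝ := 2 * (|(r:ℝ)| + |(s:ℝ)| + 1) with hC
  have hCpos : 0 < C := by positivity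
  have h1 : ∀ᶠ N : ℕ in atTop, C ^ τ / S ≤ ((2:ℝ) ^ N) ^ (1 - τ) := by
    have t1 : Tendsto (fun N : ℕ => (2:ℝ) ^ N) atTop atTop :=
      tendsto_pow_atTop_atTop_of_one_lt (by norm_num)
    exact ((tendsto_rpow_atTop (by linarith : 0 < 1 - τ)).comp t1).eventually_ge_atTop _
  obtain ⟨N, hN1, hN2, hN3⟩ := (h1.and ((eventually_ge_atTop 1).and (eventually_ge_atTop X))).exists
  have hodd : ‖((2:ℚ_[2]) ^ N + 1)‖ = 1 := by
    have := norm_odd ((2:ℤ)^N + 1) (by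
      obtain ⟨m, rfl⟩ := Nat.exists_eq_add_of_le hN2
      rw [pow_add]; simp)
    exact_mod_cast this
  have hne : ((2:ℚ_[2]) ^ N + 1) ≠ 0 := by
    intro h; rw [h, norm_zero] at hodd; norm_num at hodd
  have hdiff : (r : ℚ_[2]) / s - ((r * (2 ^ N + 1) - 2 ^ N : ℤ) : ℚ_[2]) / ((s * (2 ^ N + 1) : ℤ) : ℚ_[2])
      = 2 ^ N / (s * (2 ^ N + 1)) := by
    push_cast; field_simp; ring
  have herr : ‖(2:ℚ_[2]) ^ N / (s * (2 ^ N + 1))‖ = ((2:ℝ) ^ N)⁻¹ / S := by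
    have h2 := norm_two
    rw [norm_div, norm_mul, hodd, mul_one, norm_pow, h2, inv_pow]
  have h2N : (1:ℝ) ≤ 2 ^ N := one_le_pow₀ (by norm_num)
  have h2Nz : (1:ℤ) ≤ 2 ^ N := one_le_pow₀ (by norm_num)
  have hs1 : 1 ≤ |s| := Int.one_le_abs hs
  have hq : (2:ℤ) ^ N ≤ |s * (2 ^ N + 1)| := by
    rw [abs_mul, abs_of_pos (by positivity : (0:ℤ) < 2 ^ N + 1)]; nlinarith
  have hq0 : s * ((2:ℤ) ^ N + 1) ≠ 0 := by positivity
  refine ⟨r * (2 ^ N + 1) - 2 ^ N, s * (2 ^ N + 1), ?_, hq0, ?_, ?_⟩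
  · refine le_trans ?_ hq
    exact_mod_cast hN3.trans N.lt_two_pow_self.le
  · rw [hdiff, herr]; positivity
  · rw [hdiff, herr]
    apply rpow_compare (D := C * 2 ^ N) h0
    · have : 1 ≤ |s * ((2:ℤ) ^ N + 1)| := Int.one_le_abs hq0
      exact_mod_cast this.trans (le_max_right _ _)
    · push_cast
      apply max_le
      · have e1 := abs_sub ((r:ℝ) * (2 ^ N + 1)) (2 ^ N)
        rw [abs_mul, abs_of_pos (by positivity : (0:ℝ) < 2 ^ N), abs_of_pos (by positivity : (0:ℝ) < 2 ^ N + 1)] at e1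
        have := abs_nonneg (r:ℝ)
        have := abs_nonneg (s:ℝ)
        rw [hC]; nlinarith
      · rw [abs_mul, abs_of_pos (by positivity : (0:ℝ) < 2 ^ N + 1)]
        have := abs_nonneg (r:ℝ)
        have := abs_nonneg (s:ℝ)
        rw [hC]; nlinarith
    · rw [Real.mul_rpow hCpos.le (by positivity)]
      have e : ((2:ℝ) ^ N) ^ (1 - τ) * (2 ^ N) ^ τ = 2 ^ N := by
        rw [← Real.rpow_add (by positivity)]; simp
      have e3 : 0 < ((2:ℝ) ^ N) ^ τ := by positivity
      have : C ^ τ / S * (2 ^ N) ^ τ ≤ 2 ^ N := by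
        calc _ ≤ ((2:ℝ) ^ N) ^ (1 - τ) * (2 ^ N) ^ τ := by gcongr
          _ = _ := e
      calc ((2:ℝ) ^ N)⁻¹ / S * (C ^ τ * (2 ^ N) ^ τ) = ((2:ℝ) ^ N)⁻¹ * (C ^ τ / S * (2 ^ N) ^ τ) := by ring
        _ ≤ ((2:ℝ) ^ N)⁻¹ * 2 ^ N := by gcongr
        _ = 1 := by field_simp

lemma dirichlet (x : ℤ_[2]) (N : ℕ) (hN : 1 ≤ N) : ∃ p q : ℤ, ‖(q : ℚ_[2])‖ = 1 ∧
    ‖(x : ℚ_[2]) - p / q‖ * (max |p| |q| : ℤ) ^ 2 ≤ 1 ∧ ‖(x : ℚ_[2]) - p / q‖ ≤ (2 ^ N : ℝ)⁻¹ := by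
  let φ : Fin (2 ^ N + 1) × Fin (2 ^ N + 1) → ZMod (2 ^ (2 * N)) := fun a =>
    (a.2 : ℕ) * PadicInt.toZModPow (2 * N) x - (a.1 : ℕ)
  have hcard : Fintype.card (ZMod (2 ^ (2 * N))) < Fintype.card (Fin (2 ^ N + 1) × Fin (2 ^ N + 1)) := by
    rw [ZMod.card, Fintype.card_prod, Fintype.card_fin, two_mul, pow_add]
    nlinarith [Nat.two_pow_pos N]
  obtain ⟨⟨a, b⟩, ⟨a', b'⟩, hne, heq⟩ := Fintype.exists_ne_map_eq_of_card_lt φ hcard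
  set p : ℤ := (a : ℕ) - (a' : ℕ) with hp
  set q : ℤ := (b : ℕ) - (b' : ℕ) with hq
  have hpq : ¬ (p = 0 ∧ q = 0) := by
    rintro ⟨h1, h2⟩
    apply hne
    ext <;> simp only <;> omega
  have hpb : |p| ≤ 2 ^ N := by
    have := a.2; have := a'.2
    rw [abs_le]; zify at *; constructor <;> linarith
  have hqb : |q| ≤ 2 ^ N := by
    have := b.2; have := b'.2
    rw [abs_le]; zify at *; constructor <;> linarith
  have hmem : ‖(q : ℤ_[2]) * x - (p : ℤ_[2])‖ ≤ (2:ℝ) ^ (-(2 * N : ℕ) : ℤ) := by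
    have h0 : PadicInt.toZModPow (2 * N) ((q : ℤ_[2]) * x - (p : ℤ_[2])) = 0 := by
      simp only [φ] at heq
      rw [hp, hq]; push_cast
      simp only [map_sub, map_mul, map_natCast]
      linear_combination heq
    rw [← RingHom.mem_ker, PadicInt.ker_toZModPow] at h0
    have := (PadicInt.norm_le_pow_iff_mem_span_pow _ (2 * N)).2 h0
    exact_mod_cast this
  set g : ℕ := Int.gcd p q with hg
  have hgpos : 0 < g := by
    apply Nat.pos_of_ne_zero
    intro h; exact hpq (Int.gcd_eq_zero_iff.1 h)
  obtain ⟨p', hp'⟩ : (g:ℤ) ∣ p := Int.gcd_dvd_left ..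
  obtain ⟨q', hq'⟩ : (g:ℤ) ∣ q := Int.gcd_dvd_right ..
  have hcop : Int.gcd p' q' = 1 := by
    have := hg
    rw [hp', hq', Int.gcd_mul_left] at this
    simp only [Int.natAbs_natCast] at this
    exact (Nat.eq_of_mul_eq_mul_left hgpos (by rw [mul_one]; exact this)).symm
  have hgN : (g:ℝ) ≤ 2 ^ N := by
    have h1 : (g:ℤ) ≤ 2 ^ N := by
      by_cases h : p = 0
      · have hq0 : q ≠ 0 := fun h2 => hpq ⟨h, h2⟩
        have h3 : (g:ℤ) ≤ |q| := Int.le_of_dvd (by positivity) ((dvd_abs _ _).2 (Int.gcd_dvd_right ..))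
        exact h3.trans hqb
      · have h3 : (g:ℤ) ≤ |p| := Int.le_of_dvd (by positivity) ((dvd_abs _ _).2 (Int.gcd_dvd_left ..))
        exact h3.trans hpb
    exact_mod_cast h1
  have hgR : (0:ℝ) < g := by exact_mod_cast hgpos
  have hg1 : 1 ≤ ‖(g : ℚ_[2])‖ * g := by
    have := one_le_norm_mul_abs (g:ℤ) (by exact_mod_cast hgpos.ne')
    simpa using this
  have herr : ‖(q' : ℚ_[2]) * x - p'‖ ≤ g * ((2:ℝ) ^ N)⁻¹ ^ 2 := by
    have h1 : ‖(g : ℚ_[2])‖ * ‖(q' : ℚ_[2]) * x - p'‖ ≤ ((2:ℝ) ^ N)⁻¹ ^ 2 := by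
      rw [← norm_mul]
      have e1 : (g : ℚ_[2]) * ((q' : ℚ_[2]) * x - p') = (((q : ℤ_[2]) * x - (p : ℤ_[2]) : ℤ_[2]) : ℚ_[2]) := by
        rw [hp', hq']; push_cast; ring
      rw [e1, PadicInt.padic_norm_e_of_padicInt]
      refine hmem.trans (le_of_eq ?_)
      rw [zpow_neg, zpow_natCast, mul_comm, pow_mul, inv_pow]
    calc ‖(q' : ℚ_[2]) * x - p'‖ ≤ (‖(g : ℚ_[2])‖ * g) * ‖(q' : ℚ_[2]) * x - p'‖ :=
          le_mul_of_one_le_left (norm_nonneg _) hg1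
      _ = g * (‖(g : ℚ_[2])‖ * ‖(q' : ℚ_[2]) * x - p'‖) := by ring
      _ ≤ _ := by gcongr
  have h2N : (0:ℝ) < 2 ^ N := by positivity
  have herr2 : ‖(q' : ℚ_[2]) * x - p'‖ ≤ ((2:ℝ) ^ N)⁻¹ := by
    refine herr.trans ?_
    calc (g:ℝ) * ((2:ℝ) ^ N)⁻¹ ^ 2 ≤ 2 ^ N * ((2:ℝ) ^ N)⁻¹ ^ 2 := by gcongr
      _ = _ := by field_simp
  have hq1 : ‖(q' : ℚ_[2])‖ = 1 := by
    apply norm_odd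
    by_contra hcon
    have hq2 : (2:ℤ) ∣ q' := by omega
    have hq3 : ‖(q' : ℚ_[2])‖ < 1 := Padic.norm_intCast_lt_one_iff.2 (by exact_mod_cast hq2)
    have hp3 : ‖(p' : ℚ_[2])‖ < 1 := by
      have e : (p' : ℚ_[2]) = q' * x - (q' * x - p') := by ring
      rw [e]
      refine lt_of_le_of_lt (nsub_le_max _ _) (max_lt ?_ ?_)
      · rw [norm_mul]
        have := PadicInt.norm_le_one x
        rw [← PadicInt.padic_norm_e_of_padicInt] at this
        nlinarith [norm_nonneg (q' : ℚ_[2])]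
      · refine lt_of_le_of_lt herr2 (inv_lt_one_of_one_lt₀ (one_lt_pow₀ (by norm_num) (by omega)))
    have hp2 : (2:ℤ) ∣ p' := by exact_mod_cast (Padic.norm_intCast_lt_one_iff.1 hp3)
    have := Int.dvd_coe_gcd hp2 hq2
    rw [hcop] at this
    norm_num at this
  have hq'0 : (q' : ℚ_[2]) ≠ 0 := by
    intro h; rw [h, norm_zero] at hq1; norm_num at hq1
  have hE : ‖(x : ℚ_[2]) - p' / q'‖ = ‖(q' : ℚ_[2]) * x - p'‖ := by
    have : (q' : ℚ_[2]) * x - p' = q' * (x - p' / q') := by field_simp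
    rw [this, norm_mul, hq1, one_mul]
  refine ⟨p', q', hq1, ?_, by rw [hE]; exact herr2⟩
  rw [hE]
  have hH : (g:ℝ) * ((max |p'| |q'| : ℤ) : ℝ) ≤ 2 ^ N := by
    have : (g:ℤ) * max |p'| |q'| ≤ 2 ^ N := by
      rw [mul_max_of_nonneg _ _ (by positivity)]
      apply max_le
      · rw [hp', abs_mul] at hpb; simpa using hpb
      · rw [hq', abs_mul] at hqb; simpa using hqb
    exact_mod_cast this
  set H : ℝ := ((max |p'| |q'| : ℤ) : ℝ) with hHdef
  have hH0 : 0 ≤ H := by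
    rw [hHdef]; exact_mod_cast (abs_nonneg _).trans (le_max_left _ _)
  have hg1' : (1:ℝ) ≤ g := by exact_mod_cast hgpos
  calc ‖(q' : ℚ_[2]) * x - p'‖ * H ^ 2 ≤ g * ((2:ℝ) ^ N)⁻¹ ^ 2 * H ^ 2 := by gcongr
    _ ≤ g * ((2:ℝ) ^ N)⁻¹ ^ 2 * H ^ 2 * g := le_mul_of_one_le_right (by positivity) hg1'
    _ = (g * H) ^ 2 * ((2:ℝ) ^ N)⁻¹ ^ 2 := by ring
    _ ≤ (2 ^ N) ^ 2 * ((2:ℝ) ^ N)⁻¹ ^ 2 := by gcongr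
    _ = 1 := by field_simp

lemma good_irrat (η : ℚ_[2]) (hirr : ∀ r s : ℤ, s ≠ 0 → η ≠ r / s) (τ : ℝ) (hτ : τ < 2) :
    Good η τ := by
  wlog h0 : 0 ≤ τ
  · exact (this η hirr 0 (by norm_num) le_rfl).mono (by linarith)
  intro X
  obtain ⟨e, he⟩ : ∃ e : ℕ, ‖(2:ℚ_[2]) ^ e * η‖ ≤ 1 := by
    obtain ⟨e, he⟩ := pow_unbounded_of_one_lt ‖η‖ (by norm_num : (1:ℝ) < 2)
    refine ⟨e, ?_⟩
    rw [norm_mul, norm_pow, norm_two, inv_pow, inv_mul_le_iff₀ (by positivity), mul_one]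
    exact he.le
  set x : ℤ_[2] := ⟨2 ^ e * η, he⟩ with hx
  have hxη : (x : ℚ_[2]) = 2 ^ e * η := rfl
  have h2e : (2:ℚ_[2]) ^ e ≠ 0 := pow_ne_zero _ two_ne_zero
  have hxne : ∀ r s : ℤ, s ≠ 0 → (x : ℚ_[2]) - r / s ≠ 0 := by
    intro r s hs h
    apply hirr r (2 ^ e * s) (by positivity)
    have hs' : (s : ℚ_[2]) ≠ 0 := by exact_mod_cast hs
    rw [hxη, sub_eq_zero] at h
    push_cast
    rw [eq_div_iff (mul_ne_zero h2e hs')]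
    rw [eq_div_iff hs'] at h
    rw [← h]; ring
  set Y : ℝ := (X + 1) * 2 ^ e with hY
  have hYpos : 0 < Y := by positivity
  have hY1 : 1 ≤ Y := by
    have : (1:ℝ) ≤ 2 ^ e := one_le_pow₀ (by norm_num)
    have : (0:ℝ) ≤ X := by positivity
    rw [hY]; nlinarith
  obtain ⟨B, hB⟩ : ∃ B : ℕ, ∀ H : ℝ, (B:ℝ) ≤ H → 2 ^ e * Y ^ τ ≤ H ^ (2 - τ) := by
    have := (tendsto_rpow_atTop (by linarith : 0 < 2 - τ)).eventually_ge_atTop (2 ^ e * Y ^ τ)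
    obtain ⟨b, hb⟩ := eventually_atTop.1 this
    obtain ⟨B, hB⟩ := exists_nat_ge b
    exact ⟨B, fun H hH => hb H (hB.trans hH)⟩
  have hfin : ∀ᶠ N : ℕ in atTop, ∀ z ∈ (Finset.Icc (-(B:ℤ)) B ×ˢ Finset.Icc (-(B:ℤ)) B),
      z.2 ≠ 0 → (2 ^ N : ℝ)⁻¹ < ‖(x : ℚ_[2]) - z.1 / z.2‖ := by
    rw [Filter.eventually_all_finset]
    intro z _
    by_cases hz : z.2 = 0
    · exact Eventually.of_forall fun _ h => absurd hz h
    have hpos : 0 < ‖(x : ℚ_[2]) - z.1 / z.2‖ := norm_pos_iff.2 (hxne _ _ hz)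
    have ht : Tendsto (fun N : ℕ => ((2:ℝ) ^ N)⁻¹) atTop (nhds 0) :=
      tendsto_inv_atTop_zero.comp (tendsto_pow_atTop_atTop_of_one_lt (by norm_num))
    filter_upwards [ht.eventually_lt_const hpos] with N hN _ using hN
  obtain ⟨N, hN, hN1⟩ := (hfin.and (eventually_ge_atTop 1)).exists
  obtain ⟨p, q, hq1, h1, h2⟩ := dirichlet x N hN1
  have hq0 : q ≠ 0 := by rintro rfl; simp at hq1
  have hq' : (q : ℚ_[2]) ≠ 0 := by exact_mod_cast hq0
  set H : ℝ := ((max |p| |q| : ℤ) : ℝ) with hH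
  have hBH : (B:ℝ) ≤ H := by
    by_contra hcon
    push Not at hcon
    have hlt : max |p| |q| < (B:ℤ) := by
      rw [hH] at hcon; exact_mod_cast hcon
    have hp := (le_max_left |p| |q|).trans hlt.le
    have hq := (le_max_right |p| |q|).trans hlt.le
    rw [abs_le] at hp hq
    have := hN (p, q) (by simp [hp, hq]) hq0
    exact absurd h2 (not_le.2 this)
  have hH1 : 1 ≤ H := by
    rw [hH]; exact_mod_cast (Int.one_le_abs hq0).trans (le_max_right _ _)
  have hX0 : ((X:ℚ_[2]) + 1) ≠ 0 := by exact_mod_cast X.succ_ne_zero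
  have hdiff : η - (((X + 1) * p : ℤ) : ℚ_[2]) / (((X + 1) * 2 ^ e * q : ℤ) : ℚ_[2])
      = ((2:ℚ_[2]) ^ e)⁻¹ * (x - p / q) := by
    rw [hxη]; push_cast; field_simp
  have hnorm : ‖((2:ℚ_[2]) ^ e)⁻¹ * (x - p / q)‖ = 2 ^ e * ‖(x : ℚ_[2]) - p / q‖ := by
    rw [norm_mul, norm_inv, norm_pow, norm_two, inv_pow, inv_inv]
  have hqz : ((X:ℤ) + 1) * 2 ^ e * q ≠ 0 := by
    apply mul_ne_zero _ hq0; positivity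
  refine ⟨(X + 1) * p, (X + 1) * 2 ^ e * q, ?_, hqz, ?_, ?_⟩
  · rw [abs_mul, abs_of_pos (by positivity : (0:ℤ) < (X + 1) * 2 ^ e)]
    have := Int.one_le_abs hq0
    have h3 : (1:ℤ) ≤ 2 ^ e := one_le_pow₀ (by norm_num)
    have h4 : (X:ℤ) + 1 ≤ (X + 1) * 2 ^ e := le_mul_of_one_le_right (by positivity) h3
    nlinarith
  · rw [hdiff, hnorm]
    have := norm_pos_iff.2 (hxne p q hq0)
    positivity
  · rw [hdiff, hnorm]
    apply rpow_compare (D := Y * H) h0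
    · have : 1 ≤ |((X:ℤ) + 1) * 2 ^ e * q| := Int.one_le_abs hqz
      exact_mod_cast this.trans (le_max_right _ _)
    · have hpH : |(p:ℝ)| ≤ H := by rw [hH]; exact_mod_cast le_max_left _ _
      have hqH : |(q:ℝ)| ≤ H := by rw [hH]; exact_mod_cast le_max_right _ _
      push_cast
      apply max_le
      · rw [abs_mul, abs_of_pos (by positivity : (0:ℝ) < X + 1)]
        have : (X:ℝ) + 1 ≤ Y := le_mul_of_one_le_right (by positivity) (one_le_pow₀ (by norm_num))
        gcongr
      · rw [abs_mul, abs_of_pos (by positivity : (0:ℝ) < (X + 1) * 2 ^ e)]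
        gcongr
    · rw [Real.mul_rpow hYpos.le (by positivity)]
      have e1 : H ^ (2 - τ) * H ^ τ = H ^ 2 := by
        rw [← Real.rpow_add (by positivity)]; norm_num
      calc 2 ^ e * ‖(x : ℚ_[2]) - p / q‖ * (Y ^ τ * H ^ τ)
          = ‖(x : ℚ_[2]) - p / q‖ * ((2 ^ e * Y ^ τ) * H ^ τ) := by ring
        _ ≤ ‖(x : ℚ_[2]) - p / q‖ * (H ^ (2 - τ) * H ^ τ) := by
          gcongr; exact hB H hBH
        _ ≤ 1 := by rw [e1]; exact h1

end Zeta2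


namespace Zeta2

open Filter Topology

lemma tlim {f : ℕ → ℚ_[2]} {a b : ℚ_[2]} (h : Tendsto f atTop (𝓝 a)) (e : a = b) :
    Tendsto f atTop (𝓝 b) := e ▸ h

/-- Dyadic Riemann sums. -/
noncomputable def S (N : ℕ) (f : ℕ → ℚ_[2]) : ℚ_[2] := (∑ t ∈ Finset.range (2 ^ N), f t) / 2 ^ N

lemma norm_two_pow (N : ℕ) : ‖(2:ℚ_[2]) ^ N‖ = ((2:ℝ) ^ N)⁻¹ := by
  rw [norm_pow, norm_two, inv_pow]

lemma tendsto_two_pow : Tendsto (fun N : ℕ => (2:ℚ_[2]) ^ N) atTop (𝓝 0) :=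
  tendsto_pow_atTop_nhds_zero_of_norm_lt_one (by rw [norm_two]; norm_num)

lemma norm_le_of_dvd {z : ℤ} {m : ℕ} (h : (2:ℤ) ^ m ∣ z) : ‖(z : ℚ_[2])‖ ≤ ((2:ℝ) ^ m)⁻¹ := by
  obtain ⟨w, rfl⟩ := h
  push_cast
  rw [norm_mul, norm_two_pow]
  exact mul_le_of_le_one_right (by positivity) (Padic.norm_int_le_one w)

/-- Faulhaber formula in the dyadic setting. -/
lemma tendsto_S_pow (M : ℕ) :
    Tendsto (fun N => S N (fun t => (t : ℚ_[2]) ^ M)) atTop (𝓝 ((bernoulli M : ℚ) : ℚ_[2])) := by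
  have h : ∀ N, S N (fun t => (t : ℚ_[2]) ^ M) = ∑ i ∈ Finset.range (M + 1),
      ((bernoulli i * ((M + 1).choose i) / (M + 1) : ℚ) : ℚ_[2]) * (2 ^ N) ^ (M - i) := by
    intro N
    have h1 := sum_range_pow (2 ^ N) M
    have h2 := congrArg (fun x : ℚ => (x : ℚ_[2])) h1
    push_cast at h2
    rw [S, h2, Finset.sum_div]
    apply Finset.sum_congr rfl
    intro i hi
    have : M + 1 - i = (M - i) + 1 := by have := Finset.mem_range.1 hi; omega
    rw [this, pow_succ]
    push_cast
    field_simp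
  simp only [h]
  have hlim : ((bernoulli M : ℚ) : ℚ_[2]) = ∑ i ∈ Finset.range (M + 1),
      ((bernoulli i * ((M + 1).choose i) / (M + 1) : ℚ) : ℚ_[2]) * 0 ^ (M - i) := by
    rw [Finset.sum_range_succ, Finset.sum_eq_zero]
    · have : ((M:ℚ_[2]) + 1) ≠ 0 := by exact_mod_cast M.succ_ne_zero
      simp
      field_simp
    · intro i hi
      have := Finset.mem_range.1 hi
      rw [zero_pow (by omega), mul_zero]
  rw [hlim]
  exact tendsto_finsetSum _ fun i _ => (tendsto_two_pow.pow _).const_mul _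

lemma sum_range_double {α : Type*} [AddCommMonoid α] (f : ℕ → α) (n : ℕ) :
    ∑ t ∈ Finset.range (2 * n), f t =
      ∑ t ∈ Finset.range n, f (2 * t) + ∑ t ∈ Finset.range n, f (2 * t + 1) := by
  induction n with
  | zero => simp
  | succ n ih =>
    rw [show 2 * (n + 1) = 2 * n + 1 + 1 by ring, Finset.sum_range_succ, Finset.sum_range_succ, ih,
      Finset.sum_range_succ, Finset.sum_range_succ]
    abel

lemma pow_add_expand (x y : ℤ) (M : ℕ) : ∃ k : ℤ, (x + y) ^ M = x ^ M + M * x ^ (M - 1) * y + k * y ^ 2 :=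
  ⟨(Polynomial.powAddExpansion x y M).1, (Polynomial.powAddExpansion x y M).2⟩

/-- Integral power sums over `1 + 4 * u`. -/
def F (M N : ℕ) : ℤ := ∑ u ∈ Finset.range (2 ^ N), (1 + 4 * (u : ℤ)) ^ M

lemma F_succ (M N : ℕ) : F M (N + 1) - 2 * F M N =
    ∑ u ∈ Finset.range (2 ^ N), ((1 + 4 * (u : ℤ) + 2 ^ (N + 2)) ^ M - (1 + 4 * (u : ℤ)) ^ M) := by
  rw [F, pow_succ, mul_two, Finset.sum_range_add, Finset.sum_sub_distrib, F]
  have : ∀ u : ℕ, (1 + 4 * ((2 ^ N + u : ℕ) : ℤ)) = 1 + 4 * (u : ℤ) + 2 ^ (N + 2) := by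
    intro u; push_cast; ring
  simp only [this]
  ring

lemma two_pow_dvd_F (M N : ℕ) : (2:ℤ) ^ N ∣ F M N := by
  induction N with
  | zero => simp
  | succ N ih =>
    have h1 : (2:ℤ) ^ (N + 1) ∣ F M (N + 1) - 2 * F M N := by
      rw [F_succ]
      apply Finset.dvd_sum
      intro u _
      refine dvd_trans ?_ (sub_dvd_pow_sub_pow _ _ M)
      rw [add_sub_cancel_left]
      exact pow_dvd_pow _ (by omega)
    have h2 : (2:ℤ) ^ (N + 1) ∣ 2 * F M N := by
      rw [pow_succ, mul_comm]; exact mul_dvd_mul_left _ ih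
    simpa using dvd_add h1 h2

lemma sum_shift_dvd (M N : ℕ) (y : ℤ) (hy : (2:ℤ) ^ (N + 2) ∣ y) : (2:ℤ) ^ (2 * N + 2) ∣
    ∑ u ∈ Finset.range (2 ^ N), ((1 + 4 * (u : ℤ) + y) ^ M - (1 + 4 * (u : ℤ)) ^ M) := by
  choose k hk using fun u : ℕ => pow_add_expand (1 + 4 * (u : ℤ)) y M
  have : ∑ u ∈ Finset.range (2 ^ N), ((1 + 4 * (u : ℤ) + y) ^ M - (1 + 4 * (u : ℤ)) ^ M)
      = M * y * F (M - 1) N + y ^ 2 * ∑ u ∈ Finset.range (2 ^ N), k u := by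
    rw [F, Finset.mul_sum, Finset.mul_sum, ← Finset.sum_add_distrib]
    apply Finset.sum_congr rfl
    intro u _
    rw [hk]; ring
  rw [this]
  apply dvd_add
  · have := mul_dvd_mul (hy.mul_left (M:ℤ)) (two_pow_dvd_F (M - 1) N)
    rw [← pow_add] at this
    exact dvd_trans (pow_dvd_pow _ (by omega)) this
  · apply Dvd.dvd.mul_right
    have := pow_dvd_pow_of_dvd hy 2
    rw [← pow_mul] at this
    exact dvd_trans (pow_dvd_pow _ (by omega)) this

lemma S_eq_F (M N : ℕ) : S N (fun t => (1 + 4 * (t : ℚ_[2])) ^ M) = (F M N : ℚ_[2]) / 2 ^ N := by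
  rw [S, F]; push_cast; rfl

lemma S_step (M N : ℕ) : ‖S (N + 1) (fun t => (1 + 4 * (t : ℚ_[2])) ^ M) -
    S N (fun t => (1 + 4 * (t : ℚ_[2])) ^ M)‖ ≤ ((2:ℝ) ^ N)⁻¹ := by
  rw [S_eq_F, S_eq_F]
  have h : (F M (N + 1) : ℚ_[2]) / 2 ^ (N + 1) - F M N / 2 ^ N
      = ((F M (N + 1) - 2 * F M N : ℤ) : ℚ_[2]) / 2 ^ (N + 1) := by
    push_cast; rw [pow_succ]; field_simp
  rw [h, norm_div, norm_two_pow, F_succ]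
  have := norm_le_of_dvd (sum_shift_dvd M N (2 ^ (N + 2)) dvd_rfl)
  rw [div_inv_eq_mul]
  calc _ ≤ ((2:ℝ) ^ (2 * N + 2))⁻¹ * 2 ^ (N + 1) := by gcongr
    _ = ((2:ℝ) ^ (N + 1))⁻¹ := by
      rw [show 2 * N + 2 = (N + 1) + (N + 1) by ring, pow_add]; field_simp
    _ ≤ _ := by gcongr <;> norm_num

lemma S_cauchy (M N i : ℕ) : ‖S (N + i) (fun t => (1 + 4 * (t : ℚ_[2])) ^ M) -
    S N (fun t => (1 + 4 * (t : ℚ_[2])) ^ M)‖ ≤ ((2:ℝ) ^ N)⁻¹ := by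
  induction i with
  | zero => simp
  | succ i ih =>
    have h1 := S_step M (N + i)
    have h2 : ((2:ℝ) ^ (N + i))⁻¹ ≤ ((2:ℝ) ^ N)⁻¹ := by gcongr <;> norm_num
    have := nadd_le (h1.trans h2) ih
    simpa [add_assoc] using this

lemma reflect_sum (M N : ℕ) (hM : Even M) :
    ∑ u ∈ Finset.range (2 ^ N), (3 + 4 * (u : ℤ)) ^ M
      = ∑ u ∈ Finset.range (2 ^ N), (1 + 4 * (u : ℤ) + (- 2 ^ (N + 2))) ^ M := by
  rw [← Finset.sum_range_reflect]
  apply Finset.sum_congr rfl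
  intro u hu
  have hu := Finset.mem_range.1 hu
  rw [← hM.neg_pow]
  congr 1
  rw [Nat.cast_sub (by omega), Nat.cast_sub (by omega)]
  push_cast; ring

lemma tendsto_S_odd (M : ℕ) (hM : Even M) (hM1 : 1 ≤ M) :
    Tendsto (fun N => S N (fun t => (1 + 4 * (t : ℚ_[2])) ^ M)) atTop
      (𝓝 (2 * (1 - 2 ^ (M - 1)) * ((bernoulli M : ℚ) : ℚ_[2]))) := by
  have hdec : ∀ N, S N (fun t => (1 + 4 * (t : ℚ_[2])) ^ M) =
      2 * S (N + 2) (fun t => (t : ℚ_[2]) ^ M) - 2 ^ M * S (N + 1) (fun t => (t : ℚ_[2]) ^ M)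
      - 2⁻¹ * (((∑ u ∈ Finset.range (2 ^ N), ((1 + 4 * (u : ℤ) + (- 2 ^ (N + 2))) ^ M
        - (1 + 4 * (u : ℤ)) ^ M) : ℤ) : ℚ_[2]) / 2 ^ N) := by
    intro N
    rw [Finset.sum_sub_distrib, ← reflect_sum M N hM]
    have h1 : ∑ t ∈ Finset.range (2 ^ (N + 2)), (t : ℚ_[2]) ^ M =
        2 ^ M * ∑ t ∈ Finset.range (2 ^ (N + 1)), (t : ℚ_[2]) ^ M +
        (∑ t ∈ Finset.range (2 ^ N), (1 + 4 * (t : ℚ_[2])) ^ M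
          + ∑ t ∈ Finset.range (2 ^ N), (3 + 4 * (t : ℚ_[2])) ^ M) := by
      rw [show 2 ^ (N + 2) = 2 * 2 ^ (N + 1) by ring, sum_range_double]
      congr 1
      · rw [Finset.mul_sum]; apply Finset.sum_congr rfl; intro t _; push_cast; rw [mul_pow]
      · rw [show 2 ^ (N + 1) = 2 * 2 ^ N by ring, sum_range_double]
        congr 1 <;>
        · apply Finset.sum_congr rfl; intro t _; push_cast; ring
    simp only [S]
    rw [h1]
    push_cast
    rw [pow_succ, pow_succ]
    field_simp
    ring
  simp only [hdec]
  have hz : Tendsto (fun N => ((∑ u ∈ Finset.range (2 ^ N), ((1 + 4 * (u : ℤ) + (- 2 ^ (N + 2))) ^ M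
        - (1 + 4 * (u : ℤ)) ^ M) : ℤ) : ℚ_[2]) / 2 ^ N) atTop (𝓝 0) := by
    rw [tendsto_zero_iff_norm_tendsto_zero]
    refine squeeze_zero (fun _ => norm_nonneg _) (fun N => ?_)
      (tendsto_inv_atTop_zero.comp (tendsto_pow_atTop_atTop_of_one_lt (by norm_num : (1:ℝ) < 2)))
    rw [norm_div, norm_two_pow, div_inv_eq_mul]
    have := norm_le_of_dvd (sum_shift_dvd M N (- 2 ^ (N + 2)) (by simp))
    calc _ ≤ ((2:ℝ) ^ (2 * N + 2))⁻¹ * 2 ^ N := by gcongr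
      _ ≤ ((2:ℝ) ^ (2 * N))⁻¹ * 2 ^ N := by gcongr <;> norm_num
      _ = ((2:ℝ) ^ N)⁻¹ := by rw [two_mul, pow_add]; field_simp
  have t := (((tendsto_S_pow M).comp (tendsto_add_atTop_nat 2)).const_mul (2:ℚ_[2])).sub
    (((tendsto_S_pow M).comp (tendsto_add_atTop_nat 1)).const_mul ((2:ℚ_[2]) ^ M))
  have t2 := t.sub (hz.const_mul (2⁻¹ : ℚ_[2]))
  refine tlim t2 ?_
  obtain ⟨m, rfl⟩ := Nat.exists_eq_add_of_le hM1
  rw [Nat.add_sub_cancel_left, pow_add]; ring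

lemma S_approx (M : ℕ) (hM : Even M) (hM1 : 1 ≤ M) (N : ℕ) :
    ‖2 * (1 - 2 ^ (M - 1)) * ((bernoulli M : ℚ) : ℚ_[2]) - S N (fun t => (1 + 4 * (t : ℚ_[2])) ^ M)‖
      ≤ ((2:ℝ) ^ N)⁻¹ := by
  have h1 := ((tendsto_S_odd M hM hM1).comp (tendsto_add_atTop_nat N)).sub_const
    (S N (fun t => (1 + 4 * (t : ℚ_[2])) ^ M)) |>.norm
  refine le_of_tendsto h1 (Eventually.of_forall fun i => ?_)
  have := S_cauchy M N i
  simpa [add_comm] using this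

lemma dvd_pow_sub_one (c : ℤ) (hc : (2:ℤ) ∣ c - 1) (v w : ℕ) : (2:ℤ) ^ v ∣ c ^ (2 ^ v * w) - 1 := by
  have h : (2:ℤ) ^ v ∣ c ^ (2 ^ v) - 1 := by
    induction v with
    | zero => simp
    | succ v ih =>
      have e : c ^ (2 ^ (v + 1)) - 1 = (c ^ (2 ^ v) - 1) * (c ^ (2 ^ v) + 1) := by
        rw [pow_succ, pow_mul]; ring
      rw [e, pow_succ]
      apply mul_dvd_mul ih
      have h2 : (2:ℤ) ∣ c ^ (2 ^ v) - 1 := hc.trans (by simpa using sub_dvd_pow_sub_pow c 1 (2 ^ v))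
      omega
  rw [pow_mul]
  exact h.trans (by simpa using sub_dvd_pow_sub_pow (c ^ (2 ^ v)) 1 w)

lemma norm_pow_sub_one (c : ℤ) (hc : (2:ℤ) ∣ c - 1) (m : ℕ) :
    ‖(c : ℚ_[2]) ^ m - 1‖ ≤ ‖(m : ℚ_[2])‖ := by
  rcases Nat.eq_zero_or_pos m with rfl | hm
  · simp
  obtain ⟨v, w, hw, rfl⟩ := Nat.exists_eq_two_pow_mul_odd hm.ne'
  have h1 := norm_le_of_dvd (dvd_pow_sub_one c hc v w)
  push_cast at h1 ⊢
  rw [norm_mul, norm_two_pow]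
  have : ‖(w : ℚ_[2])‖ = 1 := by
    have := norm_odd (w:ℤ) (by exact_mod_cast (Nat.odd_iff.1 hw))
    exact_mod_cast this
  rw [this, mul_one]; exact h1

lemma norm_one_add (t : ℕ) : ‖(1 + 4 * (t : ℚ_[2]))‖ = 1 := by
  have := norm_odd (1 + 4 * (t:ℤ)) (by omega)
  exact_mod_cast this

lemma ne_of_norm_one {a : ℚ_[2]} (h : ‖a‖ = 1) : a ≠ 0 := by
  rintro rfl; simp at h

lemma norm_pow_sub_inv (c : ℤ) (hc : (2:ℤ) ∣ c - 1) (m : ℕ) :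
    ‖(c : ℚ_[2]) ^ m - ((c : ℚ_[2]) ^ 2)⁻¹‖ ≤ ‖(m : ℚ_[2]) + 2‖ := by
  have h1 : ‖(c : ℚ_[2])‖ = 1 := norm_odd c (by omega)
  have h0 := ne_of_norm_one h1
  have e : (c : ℚ_[2]) ^ m - ((c : ℚ_[2]) ^ 2)⁻¹ = ((c : ℚ_[2]) ^ 2)⁻¹ * ((c : ℚ_[2]) ^ (m + 2) - 1) := by
    field_simp; ring
  rw [e, norm_mul, norm_inv, norm_pow, h1]
  simpa using norm_pow_sub_one c hc (m + 2)

lemma S_sub_le (N : ℕ) (f g : ℕ → ℚ_[2]) (C : ℝ) (hC : 0 ≤ C) (h : ∀ t, ‖f t - g t‖ ≤ C) :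
    ‖S N f - S N g‖ ≤ 2 ^ N * C := by
  rw [S, S, ← sub_div, ← Finset.sum_sub_distrib, norm_div, norm_two_pow, div_inv_eq_mul, mul_comm]
  gcongr
  exact nsum_le _ _ hC fun i _ => h i

/-- The Volkenborn integral of the inverse square of `1 + 4 * t`. -/
lemma tendsto_S_inv (η : ℚ_[2]) (K : ℕ → ℕ) (hK : ∀ j, 0 < K j)
    (h1 : Tendsto (fun j => ‖(K j : ℚ_[2]) + 1‖) atTop (𝓝 0))
    (h2 : Tendsto
        (fun j => ((-((1 - (2 : ℚ) ^ (2 * K j - 1)) * bernoulli (2 * K j) / (2 * K j)) : ℚ) : ℚ_[2]))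
        atTop (𝓝 η)) :
    Tendsto (fun N => S N (fun t => ((1 + 4 * (t : ℚ_[2])) ^ 2)⁻¹)) atTop (𝓝 (4 * η)) := by
  have hK1 : Tendsto (fun j => (K j : ℚ_[2])) atTop (𝓝 (-1)) := by
    have := (tendsto_zero_iff_norm_tendsto_zero.2 h1).sub_const 1
    simpa using this
  have hL : Tendsto (fun j => 2 * (1 - 2 ^ (2 * K j - 1)) * ((bernoulli (2 * K j) : ℚ) : ℚ_[2]))
      atTop (𝓝 (4 * η)) := by
    have := (hK1.mul h2).const_mul (-4 : ℚ_[2])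
    refine tlim (this.congr fun j => ?_) (by ring)
    have : (K j : ℚ_[2]) ≠ 0 := by exact_mod_cast (hK j).ne'
    push_cast
    field_simp
    ring
  have key : ∀ N, ‖4 * η - S N (fun t => ((1 + 4 * (t : ℚ_[2])) ^ 2)⁻¹)‖ ≤ ((2:ℝ) ^ N)⁻¹ := by
    intro N
    have hE : Tendsto (fun j => max ((2:ℝ) ^ N)⁻¹ (2 ^ N * ‖((2 * K j : ℕ) : ℚ_[2]) + 2‖)) atTop
        (𝓝 (max ((2:ℝ) ^ N)⁻¹ (2 ^ N * 0))) := by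
      refine tendsto_const_nhds.max (Tendsto.const_mul _ ?_)
      have := h1.const_mul ‖(2:ℚ_[2])‖
      rw [mul_zero] at this
      refine this.congr fun j => ?_
      rw [← norm_mul]; congr 1; push_cast; ring
    rw [mul_zero, max_eq_left (by positivity)] at hE
    refine le_of_tendsto_of_tendsto ((hL.sub_const _).norm) hE (Eventually.of_forall fun j => ?_)
    have a1 := S_approx (2 * K j) (even_two_mul _) (by have := hK j; omega) N
    have a2 := S_sub_le N (fun t => (1 + 4 * (t : ℚ_[2])) ^ (2 * K j))
      (fun t => ((1 + 4 * (t : ℚ_[2])) ^ 2)⁻¹) ‖((2 * K j : ℕ) : ℚ_[2]) + 2‖ (norm_nonneg _) (fun t => by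
        have := norm_pow_sub_inv (1 + 4 * (t:ℤ)) ⟨2 * t, by ring⟩ (2 * K j)
        exact_mod_cast this)
    have := nadd_le (a1.trans (le_max_left _ (2 ^ N * ‖((2 * K j : ℕ) : ℚ_[2]) + 2‖)))
      (a2.trans (le_max_right ((2:ℝ) ^ N)⁻¹ _))
    simpa using this
  rw [tendsto_iff_norm_sub_tendsto_zero]
  refine squeeze_zero (fun _ => norm_nonneg _) (fun N => ?_)
      (tendsto_inv_atTop_zero.comp (tendsto_pow_atTop_atTop_of_one_lt (by norm_num : (1:ℝ) < 2)))
  rw [norm_sub_rev]; exact key N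

lemma S_shift (N : ℕ) (f : ℕ → ℚ_[2]) : S N (fun t => f (t + 1)) = S N f + (f (2 ^ N) - f 0) / 2 ^ N := by
  have h1 := Finset.sum_range_succ f (2 ^ N)
  rw [Finset.sum_range_succ'] at h1
  rw [S, S, ← add_div]
  congr 1
  linear_combination h1

lemma tendsto_shift_two (k : ℕ) (L : ℚ_[2])
    (h : Tendsto (fun N => S N (fun t => ((1 + 4 * (t : ℚ_[2])) ^ 2)⁻¹)) atTop (𝓝 L)) :
    Tendsto (fun N => S N (fun t => ((1 + 4 * ((k : ℚ_[2]) + t)) ^ 2)⁻¹)) atTop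
      (𝓝 (L - 8 * ∑ j ∈ Finset.range k, ((1 + 4 * (j : ℚ_[2])) ^ 3)⁻¹)) := by
  induction k with
  | zero => simpa using h
  | succ k ih =>
    have hk := ne_of_norm_one (norm_one_add k)
    have e : ∀ N, S N (fun t => ((1 + 4 * (((k + 1 : ℕ) : ℚ_[2]) + t)) ^ 2)⁻¹) =
        S N (fun t => ((1 + 4 * ((k : ℚ_[2]) + t)) ^ 2)⁻¹) +
        -(8 * (1 + 4 * (k : ℚ_[2])) + 16 * 2 ^ N) *
          ((1 + 4 * (k : ℚ_[2])) ^ 2 * (1 + 4 * ((k : ℚ_[2]) + 2 ^ N)) ^ 2)⁻¹ := by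
      intro N
      have := S_shift N (fun t => ((1 + 4 * ((k : ℚ_[2]) + t)) ^ 2)⁻¹)
      rw [show (fun t : ℕ => ((1 + 4 * (((k + 1 : ℕ) : ℚ_[2]) + t)) ^ 2)⁻¹) =
        fun t : ℕ => ((1 + 4 * ((k : ℚ_[2]) + (t + 1 : ℕ))) ^ 2)⁻¹ by
          funext t; push_cast; ring_nf]
      rw [this]
      congr 1
      have h2 := ne_of_norm_one (norm_one_add (k + 2 ^ N))
      push_cast at h2 ⊢
      rw [add_zero]
      field_simp
      ring
    simp only [e]
    have ht : Tendsto (fun N : ℕ => -(8 * (1 + 4 * (k : ℚ_[2])) + 16 * 2 ^ N) *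
          ((1 + 4 * (k : ℚ_[2])) ^ 2 * (1 + 4 * ((k : ℚ_[2]) + 2 ^ N)) ^ 2)⁻¹) atTop
        (𝓝 (-(8 * (1 + 4 * (k : ℚ_[2])) + 16 * 0) *
          ((1 + 4 * (k : ℚ_[2])) ^ 2 * (1 + 4 * ((k : ℚ_[2]) + 0)) ^ 2)⁻¹)) := by
      refine Tendsto.mul ?_ (Tendsto.inv₀ ?_ ?_)
      · exact ((tendsto_two_pow.const_mul 16).const_add _).neg
      · exact ((((tendsto_two_pow.const_add _).const_mul 4).const_add _).pow 2).const_mul _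
      · rw [add_zero]; positivity
    refine tlim (ih.add ht) ?_
    rw [Finset.sum_range_succ, add_zero]
    field_simp
    ring

lemma tendsto_shift_one (k : ℕ) :
    Tendsto (fun N => S N (fun t => (1 + 4 * ((k : ℚ_[2]) + t))⁻¹) - S N (fun t => (1 + 4 * (t : ℚ_[2]))⁻¹))
      atTop (𝓝 (- 4 * ∑ j ∈ Finset.range k, ((1 + 4 * (j : ℚ_[2])) ^ 2)⁻¹)) := by
  induction k with
  | zero => simp
  | succ k ih =>
    have hk := ne_of_norm_one (norm_one_add k)
    have e : ∀ N, S N (fun t => (1 + 4 * (((k + 1 : ℕ) : ℚ_[2]) + t))⁻¹) =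
        S N (fun t => (1 + 4 * ((k : ℚ_[2]) + t))⁻¹) +
        -4 * ((1 + 4 * (k : ℚ_[2])) * (1 + 4 * ((k : ℚ_[2]) + 2 ^ N)))⁻¹ := by
      intro N
      have := S_shift N (fun t => (1 + 4 * ((k : ℚ_[2]) + t))⁻¹)
      rw [show (fun t : ℕ => (1 + 4 * (((k + 1 : ℕ) : ℚ_[2]) + t))⁻¹) =
        fun t : ℕ => (1 + 4 * ((k : ℚ_[2]) + (t + 1 : ℕ)))⁻¹ by
          funext t; push_cast; ring_nf]
      rw [this]
      congr 1
      have h2 := ne_of_norm_one (norm_one_add (k + 2 ^ N))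
      push_cast at h2 ⊢
      rw [add_zero]
      field_simp
      ring
    simp only [e]
    have ht : Tendsto (fun N : ℕ => -4 * ((1 + 4 * (k : ℚ_[2])) * (1 + 4 * ((k : ℚ_[2]) + 2 ^ N)))⁻¹) atTop
        (𝓝 (-4 * ((1 + 4 * (k : ℚ_[2])) * (1 + 4 * ((k : ℚ_[2]) + 0)))⁻¹)) := by
      refine Tendsto.const_mul _ (Tendsto.inv₀ ?_ ?_)
      · exact ((((tendsto_two_pow.const_add _).const_mul 4).const_add _)).const_mul _
      · rw [add_zero]; exact mul_ne_zero hk hk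
    refine tlim (Tendsto.congr (fun N => ?_) (ih.add ht)) ?_
    · ring
    rw [Finset.sum_range_succ, add_zero]
    field_simp
    ring

end Zeta2


namespace Zeta2

open Filter Topology

/-- Finite Mahler expansions with controlled coefficients. -/
def Mah (n : ℕ) (f : ℕ → ℤ) : Prop :=
  ∃ (L : ℕ) (a : ℕ → ℤ), (∀ t : ℕ, f t = ∑ m ∈ Finset.range L, a m * (t.choose m : ℤ)) ∧
    (∀ m, (4:ℤ) ^ (m - 2 * n) ∣ a m) ∧ a n % 2 = 1 ∧ ∀ m, L ≤ m → a m = 0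

lemma mul_choose (t m : ℕ) : (t : ℤ) * (t.choose m : ℤ) =
    m * (t.choose m : ℤ) + (m + 1) * (t.choose (m + 1) : ℤ) := by
  have h1 := Nat.add_one_mul_choose_eq t m
  have h2 := Nat.choose_succ_succ t m
  simp only [Nat.succ_eq_add_one] at h2
  rw [h2] at h1
  zify at h1
  linear_combination h1

lemma Mah.step {n : ℕ} {f : ℕ → ℤ} (h : Mah n f) (c : ℤ) (hc : c % 2 = 1) :
    Mah n (fun t => f t * (c + 4 * t)) := by
  obtain ⟨L, a, h1, h2, h3, h4⟩ := h
  refine ⟨L + 1, fun m => (c + 4 * m) * a m + 4 * m * a (m - 1), ?_, ?_, ?_, ?_⟩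
  · intro t
    beta_reduce
    rw [h1, Finset.sum_mul]
    have e1 : ∀ m ∈ Finset.range L, a m * (t.choose m : ℤ) * (c + 4 * t) =
        (c + 4 * m) * a m * (t.choose m : ℤ) +
        4 * ((m + 1 : ℕ) : ℤ) * a (m + 1 - 1) * (t.choose (m + 1) : ℤ) := by
      intro m _
      have := mul_choose t m
      rw [Nat.add_sub_cancel]
      push_cast
      linear_combination 4 * a m * this
    rw [Finset.sum_congr rfl e1, Finset.sum_add_distrib]
    have e2 : ∀ m ∈ Finset.range (L + 1), ((c + 4 * m) * a m + 4 * m * a (m - 1)) * (t.choose m : ℤ) =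
        (c + 4 * m) * a m * (t.choose m : ℤ) + 4 * m * a (m - 1) * (t.choose m : ℤ) := by
      intro m _; ring
    rw [Finset.sum_congr rfl e2, Finset.sum_add_distrib]
    congr 1
    · rw [Finset.sum_range_succ, h4 L le_rfl]
      simp
    · rw [Finset.sum_range_succ' (fun m : ℕ => 4 * (m : ℤ) * a (m - 1) * (t.choose m : ℤ))]
      simp
  · intro m
    apply dvd_add
    · exact (h2 m).mul_left _
    · rcases Nat.eq_zero_or_pos m with rfl | hm
      · simp
      · have := mul_dvd_mul (dvd_refl (4:ℤ)) (h2 (m - 1))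
        rw [← pow_succ'] at this
        have h5 : (4:ℤ) ^ (m - 2 * n) ∣ 4 * a (m - 1) := (pow_dvd_pow _ (by omega)).trans this
        rw [show 4 * (m:ℤ) * a (m - 1) = m * (4 * a (m - 1)) by ring]
        exact h5.mul_left _
  · have e : (c + 4 * n) * a n + 4 * n * a (n - 1) = c * a n + 2 * (2 * n * a n + 2 * n * a (n - 1)) := by ring
    have : c * a n % 2 = 1 := by rw [Int.mul_emod, hc, h3]; rfl
    simp only [e]
    omega
  · intro m hm
    simp only [h4 m (by omega), h4 (m - 1) (by omega)]
    simp

lemma Mah.pow {n : ℕ} {f : ℕ → ℤ} (h : Mah n f) (c : ℤ) (hc : c % 2 = 1) (M : ℕ) :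
    Mah n (fun t => f t * (c + 4 * t) ^ M) := by
  induction M with
  | zero => simpa using h
  | succ M ih =>
    have := ih.step c hc
    simpa [pow_succ, mul_assoc] using this

lemma Mah.prod {n : ℕ} {f : ℕ → ℤ} (h : Mah n f) (M r : ℕ) :
    Mah n (fun t => f t * (∏ k ∈ Finset.range r, (1 + 4 * ((k:ℤ) + t))) ^ M) := by
  induction r with
  | zero => simpa using h
  | succ r ih =>
    have := ih.pow (1 + 4 * (r:ℤ)) (by omega) M
    convert this using 2 with t
    rw [Finset.prod_range_succ, mul_pow, ← mul_assoc]
    ring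

lemma even_of_mul_eq {a i x y : ℕ} (hi : 0 < i) (hia : i < 2 ^ a) (h : i * x = 2 ^ a * y) : x % 2 = 0 := by
  by_contra hx
  have hc : Nat.Coprime (2 ^ a) x := by
    apply Nat.Coprime.pow_left
    rw [Nat.coprime_two_left, Nat.odd_iff]; omega
  have : 2 ^ a ∣ i := hc.dvd_of_dvd_mul_right ⟨y, h⟩
  exact absurd (Nat.le_of_dvd hi this) (by omega)

lemma choose_even (a i : ℕ) (hi : 0 < i) (hia : i < 2 ^ a) :
    (2 ^ a - 1 + i).choose (2 ^ a - 1) % 2 = 0 := by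
  obtain ⟨j, rfl⟩ := Nat.exists_eq_succ_of_ne_zero hi.ne'
  have h1 : 1 ≤ 2 ^ a := Nat.one_le_two_pow
  have h2 := Nat.choose_succ_right_eq (2 ^ a - 1 + (j + 1)) j
  rw [show 2 ^ a - 1 + (j + 1) - j = 2 ^ a by omega] at h2
  have h3 : (2 ^ a - 1 + (j + 1)).choose (2 ^ a - 1) = (2 ^ a - 1 + (j + 1)).choose (j + 1) := by
    rw [Nat.choose_symm_add]
  rw [Nat.succ_eq_add_one, h3]
  exact even_of_mul_eq (y := (2 ^ a - 1 + (j + 1)).choose j) hi hia (by rw [mul_comm, h2, mul_comm])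

lemma choose_odd (N i : ℕ) (h : i < 2 ^ N) : (2 ^ N - 1).choose i % 2 = 1 := by
  induction i with
  | zero => simp
  | succ i ih =>
    have ih := ih (by omega)
    have h1 := Nat.choose_succ_succ (2 ^ N - 1) i
    have h2 := Nat.add_one_mul_choose_eq (2 ^ N - 1) i
    have h3 : 2 ^ N - 1 + 1 = 2 ^ N := by omega
    simp only [Nat.succ_eq_add_one, h3] at h1 h2
    have := even_of_mul_eq (Nat.succ_pos i) h (x := (2 ^ N).choose (i + 1)) (y := (2 ^ N - 1).choose i)
      (by rw [h2, mul_comm])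
    omega

lemma sum_choose (m r : ℕ) : ∑ t ∈ Finset.range r, t.choose m = r.choose (m + 1) := by
  induction r with
  | zero => simp
  | succ r ih => rw [Finset.sum_range_succ, ih, Nat.choose_succ_succ, add_comm]

lemma S_choose (N m : ℕ) : S N (fun t => (t.choose m : ℚ_[2])) = ((2 ^ N - 1).choose m : ℚ_[2]) / (m + 1) := by
  have h1 := sum_choose m (2 ^ N)
  have h2 := Nat.add_one_mul_choose_eq (2 ^ N - 1) m
  have h3 : 2 ^ N - 1 + 1 = 2 ^ N := Nat.sub_add_cancel Nat.one_le_two_pow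
  rw [h3] at h2
  have h4 : ((m:ℚ_[2]) + 1) ≠ 0 := by exact_mod_cast m.succ_ne_zero
  rw [S]
  have h5 : (∑ t ∈ Finset.range (2 ^ N), (t.choose m : ℚ_[2])) = ((2 ^ N).choose (m + 1) : ℚ_[2]) := by
    exact_mod_cast h1
  have h6 : (2:ℚ_[2]) ^ N * ((2 ^ N - 1).choose m : ℚ_[2]) = ((2 ^ N).choose (m + 1) : ℚ_[2]) * (m + 1) := by
    exact_mod_cast h2
  rw [h5, div_eq_div_iff (pow_ne_zero _ two_ne_zero) h4, ← h6]; ring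

lemma mah_base (a : ℕ) : Mah (2 ^ a - 1) (fun t => ((t + (2 ^ a - 1)).choose (2 ^ a - 1) : ℤ) ^ 2) := by
  set n := 2 ^ a - 1 with hn
  have hn1 : n + 1 = 2 ^ a := Nat.sub_add_cancel Nat.one_le_two_pow
  let P : Polynomial ℚ := (Polynomial.C (1 / (n.factorial : ℚ)) * (ascPochhammer ℚ n).comp (Polynomial.X + 1)) ^ 2
  have hP : ∀ t : ℕ, P.eval (t : ℚ) = (((t + n).choose n : ℤ) : ℚ) ^ 2 := by
    intro t
    simp only [P, Polynomial.eval_pow, Polynomial.eval_mul, Polynomial.eval_C, Polynomial.eval_comp,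
      Polynomial.eval_add, Polynomial.eval_X, Polynomial.eval_one]
    congr 1
    have h1 := ascPochhammer_nat_eq_ascFactorial (t + 1) n
    rw [Nat.ascFactorial_eq_factorial_mul_choose] at h1
    have h2 := ascPochhammer_eval_cast (S := ℚ) n (t + 1)
    rw [h1] at h2
    push_cast at h2 ⊢
    rw [← h2]
    have : (n.factorial : ℚ) ≠ 0 := by exact_mod_cast n.factorial_ne_zero
    field_simp
  have hdeg : P.natDegree ≤ 2 * n := by
    refine Polynomial.natDegree_pow_le.trans ?_
    gcongr
    refine (Polynomial.natDegree_C_mul_le _ _).trans ?_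
    rw [Polynomial.natDegree_comp, ascPochhammer_natDegree]
    have : (Polynomial.X + 1 : Polynomial ℚ).natDegree = 1 := by
      simpa using Polynomial.natDegree_X_add_C (1:ℚ)
    rw [this, mul_one]
  let b : ℕ → ℤ := fun m => ∑ i ∈ Finset.range (m + 1), (-1) ^ (m - i) * (m.choose i : ℤ) *
    ((i + n).choose n : ℤ) ^ 2
  have hb : ∀ m, (fwdDiff (1:ℚ))^[m] (fun x => P.eval x) 0 = (b m : ℚ) := by
    intro m
    rw [fwdDiff_iter_eq_sum_shift]
    simp only [b]
    push_cast
    apply Finset.sum_congr rfl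
    intro i _
    have := hP i
    simp only [nsmul_eq_mul, mul_one, zero_add]
    rw [this]
    push_cast
    simp
  have hb0 : ∀ m, 2 * n < m → b m = 0 := by
    intro m hm
    have h1 := hb m
    rw [Polynomial.fwdDiff_iter_eq_zero_of_degree_lt (by omega)] at h1
    have h2 : ((b m : ℤ) : ℚ) = 0 := h1.symm
    exact_mod_cast h2
  refine ⟨2 * n + 1, b, ?_, ?_, ?_, fun m hm => hb0 m (by omega)⟩
  · intro t
    have h1 := shift_eq_sum_fwdDiff_iter (1:ℚ) (fun x => P.eval x) t 0
    simp only [hb] at h1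
    simp only [nsmul_eq_mul, mul_one, zero_add] at h1
    rw [hP] at h1
    have h2 : ((t + n).choose n : ℤ) ^ 2 = ∑ m ∈ Finset.range (t + 1), b m * (t.choose m : ℤ) := by
      have : (((t + n).choose n : ℤ) : ℚ) ^ 2 = ∑ m ∈ Finset.range (t + 1), (b m : ℚ) * (t.choose m : ℚ) := by
        rw [h1]; apply Finset.sum_congr rfl; intro i _; ring
      exact_mod_cast this
    beta_reduce
    rw [h2]
    have e1 : ∑ m ∈ Finset.range (t + 1), b m * (t.choose m : ℤ) =
        ∑ m ∈ Finset.range (t + 1 + (2 * n + 1)), b m * (t.choose m : ℤ) := by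
      apply Finset.sum_subset
      · intro x; simp; omega
      · intro x _ hx
        rw [Nat.choose_eq_zero_of_lt (by simpa using hx)]; simp
    have e2 : ∑ m ∈ Finset.range (2 * n + 1), b m * (t.choose m : ℤ) =
        ∑ m ∈ Finset.range (t + 1 + (2 * n + 1)), b m * (t.choose m : ℤ) := by
      apply Finset.sum_subset
      · intro x; simp; omega
      · intro x _ hx
        rw [hb0 x (by simp at hx; omega)]; simp
    rw [e1, e2]
  · intro m
    by_cases hm : 2 * n < m
    · rw [hb0 m hm]; simp
    · rw [show m - 2 * n = 0 by omega]; simp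
  · have h1 : b n = (∑ i ∈ Finset.range n, (-1) ^ (n - (i + 1)) * (n.choose (i + 1) : ℤ) *
      ((i + 1 + n).choose n : ℤ) ^ 2) + (-1) ^ n := by
      simp only [b]
      rw [Finset.sum_range_succ']
      simp
    have h2 : (2:ℤ) ∣ ∑ i ∈ Finset.range n, (-1) ^ (n - (i + 1)) * (n.choose (i + 1) : ℤ) *
      ((i + 1 + n).choose n : ℤ) ^ 2 := by
      apply Finset.dvd_sum
      intro i hi
      apply Dvd.dvd.mul_left
      have hi := Finset.mem_range.1 hi
      have := choose_even a (i + 1) (by omega) (by omega)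
      rw [← hn, add_comm] at this
      exact Dvd.dvd.pow (by omega) (by norm_num)
    rcases neg_one_pow_eq_or ℤ n with h | h <;> rw [h] at h1 <;> omega

lemma nsum_lt {ι : Type*} (s : Finset ι) (f : ι → ℚ_[2]) {C : ℝ} (hC : 0 < C) (h : ∀ i ∈ s, ‖f i‖ < C) :
    ‖∑ i ∈ s, f i‖ < C := by
  classical
  induction s using Finset.induction_on with
  | empty => simpa using hC
  | insert i s hi ih =>
    rw [Finset.sum_insert hi]
    exact lt_of_le_of_lt (nadd_le_max _ _) (max_lt (h i (by simp)) (ih fun j hj => h j (by simp [hj])))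

lemma S_sum {ι : Type*} (s : Finset ι) (N : ℕ) (f : ι → ℕ → ℚ_[2]) :
    S N (fun t => ∑ i ∈ s, f i t) = ∑ i ∈ s, S N (f i) := by
  simp only [S]
  rw [Finset.sum_comm, Finset.sum_div]

lemma S_mul (N : ℕ) (c : ℚ_[2]) (f : ℕ → ℚ_[2]) : S N (fun t => c * f t) = c * S N f := by
  simp only [S]
  rw [← Finset.mul_sum, mul_div_assoc]

lemma norm_pow_lt (a x : ℕ) (h : ¬ 2 ^ a ∣ x) : 1 < 2 ^ a * ‖(x : ℚ_[2])‖ := by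
  by_contra hc
  apply h
  have h1 : ‖((x : ℤ) : ℚ_[2])‖ ≤ (2:ℝ) ^ (-(a:ℤ)) := by
    rw [zpow_neg, zpow_natCast]
    push_cast
    rw [← one_div, le_div_iff₀ (by positivity)]; linarith
  have h2 := (Padic.norm_int_le_pow_iff_dvd (p := 2) (x : ℤ) a).1 (by exact_mod_cast h1)
  exact_mod_cast h2

lemma mah_norm (a N : ℕ) (hN : a ≤ N) (f : ℕ → ℤ) (h : Mah (2 ^ a - 1) f) :
    ‖S N (fun t => (f t : ℚ_[2]))‖ = 2 ^ a := by
  set n := 2 ^ a - 1 with hn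
  have hn1 : n + 1 = 2 ^ a := Nat.sub_add_cancel Nat.one_le_two_pow
  obtain ⟨L, b, h1, h2, h3, h4⟩ := h
  have e : S N (fun t => (f t : ℚ_[2])) = ∑ m ∈ Finset.range L,
      (b m : ℚ_[2]) * (((2 ^ N - 1).choose m : ℚ_[2]) / (m + 1)) := by
    simp only [← S_choose]
    simp only [← S_mul]
    rw [← S_sum]
    congr 1
    funext t
    rw [h1]; push_cast; rfl
  have hnL : n ∈ Finset.range L := by
    by_contra hc
    have := h4 n (by simpa using hc)
    omega
  rw [e, ← Finset.add_sum_erase _ _ hnL]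
  have hmain : ‖(b n : ℚ_[2]) * (((2 ^ N - 1).choose n : ℚ_[2]) / (n + 1))‖ = 2 ^ a := by
    have c1 : ‖((2 ^ N - 1).choose n : ℚ_[2])‖ = 1 := by
      have hlt : n < 2 ^ N := by
        have := Nat.pow_le_pow_right (show 0 < 2 by norm_num) hN
        omega
      have := choose_odd N n hlt
      have := norm_odd ((2 ^ N - 1).choose n : ℤ) (by exact_mod_cast this)
      exact_mod_cast this
    have c2 : ((n:ℚ_[2]) + 1) = 2 ^ a := by exact_mod_cast hn1
    rw [norm_mul, norm_div, norm_odd _ h3, c1, c2, norm_two_pow]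
    simp
  have hrest : ‖∑ m ∈ (Finset.range L).erase n,
      (b m : ℚ_[2]) * (((2 ^ N - 1).choose m : ℚ_[2]) / (m + 1))‖ < 2 ^ a := by
    apply nsum_lt _ _ (by positivity)
    intro m hm
    have hmn : m ≠ n := (Finset.mem_erase.1 hm).1
    have c1 : ‖((2 ^ N - 1).choose m : ℚ_[2])‖ ≤ 1 := by
      exact_mod_cast Padic.norm_int_le_one (p := 2) ((2 ^ N - 1).choose m : ℤ)
    have c3 : 0 < ‖((m + 1 : ℕ) : ℚ_[2])‖ := norm_pos_iff.2 (by exact_mod_cast m.succ_ne_zero)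
    have key : ‖(b m : ℚ_[2])‖ < 2 ^ a * ‖((m + 1 : ℕ) : ℚ_[2])‖ := by
      by_cases hm2 : m ≤ 2 * n
      · refine lt_of_le_of_lt (Padic.norm_int_le_one _) (norm_pow_lt a (m + 1) ?_)
        rintro ⟨q, hq⟩
        rcases q with _ | _ | q
        · omega
        · omega
        · have : 2 ^ a * (q + 1 + 1) = 2 ^ a * q + 2 * 2 ^ a := by ring
          have h5 : 0 ≤ 2 ^ a * q := Nat.zero_le _
          omega
      · obtain ⟨j, rfl⟩ := Nat.exists_eq_add_of_lt (not_le.1 hm2)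
        have d1 := h2 (2 * n + j + 1)
        rw [show 2 * n + j + 1 - 2 * n = j + 1 by omega, show (4:ℤ) = 2 ^ 2 by norm_num, ← pow_mul] at d1
        have d2 := norm_le_of_dvd d1
        refine lt_of_le_of_lt d2 ?_
        have d3 := one_le_norm_mul_abs ((2 * n + j + 1 + 1 : ℕ) : ℤ) (by omega)
        rw [abs_of_nonneg (by positivity)] at d3
        have d4 : 2 * n + j + 1 + 1 < 2 ^ a * 2 ^ (2 * (j + 1)) := by
          rw [← hn1, pow_mul]
          have : 1 + (j + 1) * 3 ≤ (2 ^ 2) ^ (j + 1) := by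
            clear * -
            induction j with
            | zero => norm_num
            | succ j ih => rw [pow_succ]; omega
          nlinarith
        have d5 : ((2 * n + j + 1 + 1 : ℕ) : ℝ) < 2 ^ a * 2 ^ (2 * (j + 1)) := by exact_mod_cast d4
        rw [← one_div, div_lt_iff₀ (by positivity)]
        have d6 : (1:ℝ) ≤ ‖((2 * n + j + 1 + 1 : ℕ) : ℚ_[2])‖ * ((2 * n + j + 1 + 1 : ℕ) : ℝ) := by
          exact_mod_cast d3
        nlinarith
    push_cast at c3 key
    rw [norm_mul, norm_div, ← mul_div_assoc, div_lt_iff₀ c3]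
    exact lt_of_le_of_lt (mul_le_of_le_one_right (norm_nonneg _) c1) key
  rw [Padic.add_eq_max_of_ne (by rw [hmain]; exact hrest.ne'), hmain, max_eq_left hrest.le]

lemma exact_norm (a N : ℕ) (ha : 1 ≤ a) (hN : a ≤ N) (n : ℕ) (hn : n = 2 ^ a - 1) :
    ‖S N (fun t => ((t + n).choose n : ℚ_[2]) ^ 2 *
      ((∏ k ∈ Finset.range (n + 1), (1 + 4 * ((k : ℚ_[2]) + t))) ^ 2)⁻¹)‖ = 2 ^ a := by
  have hN2 : 2 ≤ 2 ^ N := by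
    calc 2 = 2 ^ 1 := by norm_num
      _ ≤ 2 ^ N := Nat.pow_le_pow_right (by norm_num) (by omega)
  have h1 := mah_norm a N hN _ ((mah_base a).prod (2 ^ N - 2) (n + 1))
  rw [← hn] at h1
  have h2 := S_sub_le N (fun t => ((t + n).choose n : ℚ_[2]) ^ 2 *
      ((∏ k ∈ Finset.range (n + 1), (1 + 4 * ((k : ℚ_[2]) + t))) ^ 2)⁻¹)
    (fun t => ((((t + n).choose n : ℤ) ^ 2 *
      (∏ k ∈ Finset.range (n + 1), (1 + 4 * ((k : ℤ) + t))) ^ (2 ^ N - 2) : ℤ) : ℚ_[2]))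
    ((2:ℝ) ^ N)⁻¹ (by positivity) (fun t => by
      have hc : (2:ℤ) ∣ (∏ k ∈ Finset.range (n + 1), (1 + 4 * ((k : ℤ) + t))) - 1 := by
        rw [← Int.modEq_iff_dvd]
        symm
        have : ∀ s : Finset ℕ, ∏ k ∈ s, (1 + 4 * ((k : ℤ) + t)) ≡ 1 [ZMOD 2] := by
          intro s
          induction s using Finset.induction_on with
          | empty => rfl
          | insert i s hi ih =>
            rw [Finset.prod_insert hi]
            have : (1 + 4 * ((i : ℤ) + t)) ≡ 1 [ZMOD 2] := by
              unfold Int.ModEq; omega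
            simpa using this.mul ih
        exact this _
      have h3 := norm_pow_sub_inv _ hc (2 ^ N - 2)
      rw [Nat.cast_sub hN2] at h3
      push_cast at h3 ⊢
      rw [← mul_sub, norm_mul, norm_sub_rev]
      rw [show (2:ℚ_[2]) ^ N - 2 + 2 = 2 ^ N by ring, norm_two_pow] at h3
      refine le_trans (mul_le_of_le_one_left (norm_nonneg _) ?_) h3
      have := Padic.norm_int_le_one (p := 2) (((t + n).choose n : ℤ) ^ 2)
      exact_mod_cast this)
  rw [mul_inv_cancel₀ (by positivity)] at h2
  have h3 : (1:ℝ) < 2 ^ a := one_lt_pow₀ (by norm_num) (by omega)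
  set A := S N (fun t => ((t + n).choose n : ℚ_[2]) ^ 2 *
      ((∏ k ∈ Finset.range (n + 1), (1 + 4 * ((k : ℚ_[2]) + t))) ^ 2)⁻¹)
  set B := S N (fun t => ((((t + n).choose n : ℤ) ^ 2 *
      (∏ k ∈ Finset.range (n + 1), (1 + 4 * ((k : ℤ) + t))) ^ (2 ^ N - 2) : ℤ) : ℚ_[2]))
  have h4 : ‖B‖ = 2 ^ a := h1
  have h5 : A = (A - B) + B := by ring
  have h6 : ‖A - B‖ < ‖B‖ := by rw [h4]; linarith
  rw [h5, Padic.add_eq_max_of_ne h6.ne, max_eq_right h6.le, h4]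

end Zeta2


namespace Zeta2

open Filter Topology

/-- Partial fraction coefficients. -/
def cc (n k : ℕ) : ℚ := (∏ i ∈ Finset.range n, ((i:ℚ) + 3 / 4 - k)) *
  ∏ l ∈ (Finset.range (n + 1)).erase k, ((l:ℚ) - k)⁻¹

/-- The residue coefficients of the square. -/
def bb (n k : ℕ) : ℚ := ∑ l ∈ Finset.range (n + 1), 2 * cc n k * cc n l / ((l:ℚ) - k)

/-- The rational function, in partial fraction form. -/
def GG (n : ℕ) (t : ℚ) : ℚ := ∑ k ∈ Finset.range (n + 1), cc n k / (t + 1 / 4 + k)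

lemma GG_prod (n : ℕ) (t : ℚ) (ht : ∀ k ∈ Finset.range (n + 1), t + 1 / 4 + (k:ℚ) ≠ 0) :
    ∏ i ∈ Finset.range n, (t + i + 1) = (∏ k ∈ Finset.range (n + 1), (t + 1 / 4 + (k:ℚ))) * GG n t := by
  let P : Polynomial ℚ := ∏ i ∈ Finset.range n, (Polynomial.X + Polynomial.C ((i:ℚ) + 1))
  let v : ℕ → ℚ := fun k => -(1 / 4) - k
  have hv : Set.InjOn v (Finset.range (n + 1) : Finset ℕ) := by
    intro x _ y _ h
    simp only [v] at h
    have : (x:ℚ) = y := by linarith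
    exact_mod_cast this
  have hdeg : P.degree < (Finset.range (n + 1)).card := by
    have h1 : P.natDegree = n := by
      rw [Polynomial.natDegree_prod _ _ (fun i _ => Polynomial.X_add_C_ne_zero _)]
      simp only [Polynomial.natDegree_X_add_C]
      simp
    refine lt_of_le_of_lt Polynomial.degree_le_natDegree ?_
    rw [h1, Finset.card_range]
    exact_mod_cast n.lt_succ_self
  have h := congrArg (Polynomial.eval t) (Lagrange.eq_interpolate hv hdeg)
  rw [Lagrange.eval_interpolate_not_at_node _ (by
    intro i hi hc
    apply ht i hi
    rw [hc]; simp only [v]; ring), Lagrange.eval_nodal] at h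
  have e1 : Polynomial.eval t P = ∏ i ∈ Finset.range n, (t + i + 1) := by
    simp only [P, Polynomial.eval_prod, Polynomial.eval_add, Polynomial.eval_X, Polynomial.eval_C, add_assoc]
  rw [e1] at h
  rw [h]
  congr 1
  · apply Finset.prod_congr rfl; intro i _; simp only [v]; ring
  · rw [GG]
    apply Finset.sum_congr rfl
    intro k _
    have e2 : Polynomial.eval (v k) P = ∏ i ∈ Finset.range n, ((i:ℚ) + 3 / 4 - k) := by
      simp only [P, Polynomial.eval_prod, Polynomial.eval_add, Polynomial.eval_X, Polynomial.eval_C]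
      apply Finset.prod_congr rfl; intro i _; simp only [v]; ring
    have e3 : Lagrange.nodalWeight (Finset.range (n + 1)) v k =
        ∏ l ∈ (Finset.range (n + 1)).erase k, ((l:ℚ) - k)⁻¹ := by
      rw [Lagrange.nodalWeight]
      apply Finset.prod_congr rfl; intro i _; simp only [v]; congr 1; ring
    have e4 : t - v k = t + 1 / 4 + k := by simp only [v]; ring
    rw [e2, e3, e4, cc, div_eq_mul_inv]; ring

lemma quarter_ne (z : ℤ) (k : ℕ) : (z:ℚ) + 1 / 4 + k ≠ 0 := by
  intro h
  have : 4 * (z:ℚ) + 1 + 4 * k = 0 := by linarith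
  have h2 : 4 * z + 1 + 4 * k = 0 := by exact_mod_cast this
  omega

lemma GG_zero (n i : ℕ) (hi : i < n) : GG n (-((i:ℚ) + 1)) = 0 := by
  have hne : ∀ k ∈ Finset.range (n + 1), -((i:ℚ) + 1) + 1 / 4 + (k:ℚ) ≠ 0 := by
    intro k _
    have := quarter_ne (-(i + 1)) k
    push_cast at this ⊢
    exact this
  have h := GG_prod n (-((i:ℚ) + 1)) hne
  rw [Finset.prod_eq_zero (Finset.mem_range.2 hi) (by ring)] at h
  rcases mul_eq_zero.1 h.symm with h | h
  · exact absurd h (Finset.prod_ne_zero_iff.2 hne)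
  · exact h

section generic

variable (s : Finset ℕ) (c y : ℕ → ℚ)

lemma sq_identity (hy : ∀ k ∈ s, y k ≠ 0) (hd : ∀ k ∈ s, ∀ l ∈ s, y l - y k = (l:ℚ) - k) :
    (∑ k ∈ s, c k / y k) ^ 2 = ∑ k ∈ s, c k ^ 2 / y k ^ 2 +
      ∑ k ∈ s, (∑ l ∈ s, 2 * c k * c l / ((l:ℚ) - k)) / y k := by
  have e1 : (∑ k ∈ s, c k / y k) ^ 2 = ∑ k ∈ s, ∑ l ∈ s, ((if k = l then c k ^ 2 / y k ^ 2 else 0)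
      + (c k * c l / ((l:ℚ) - k) / y k + c l * c k / ((k:ℚ) - l) / y l)) := by
    rw [sq, Finset.sum_mul_sum]
    apply Finset.sum_congr rfl; intro k hk
    apply Finset.sum_congr rfl; intro l hl
    have h1 := hy k hk
    have h2 := hy l hl
    by_cases h : k = l
    · subst h; simp; field_simp
    · rw [if_neg h]
      have h3 : (l:ℚ) - k ≠ 0 := sub_ne_zero.2 (by exact_mod_cast Ne.symm h)
      have h4 : (k:ℚ) - l ≠ 0 := sub_ne_zero.2 (by exact_mod_cast h)
      have h5 := hd k hk l hl
      rw [← neg_sub (l:ℚ) k]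
      rw [← h5] at h3 ⊢
      field_simp
      ring
  rw [e1]
  simp only [Finset.sum_add_distrib]
  congr 1
  · apply Finset.sum_congr rfl; intro k hk
    rw [Finset.sum_ite_eq]; simp [hk]
  · rw [Finset.sum_comm (f := fun k l => c l * c k / ((k:ℚ) - l) / y l), ← Finset.sum_add_distrib]
    apply Finset.sum_congr rfl; intro k hk
    rw [← Finset.sum_add_distrib, Finset.sum_div]
    apply Finset.sum_congr rfl; intro l hl
    ring

lemma cube_identity (hy : ∀ k ∈ s, y k ≠ 0) (hd : ∀ k ∈ s, ∀ l ∈ s, y l - y k = (l:ℚ) - k) :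
    2 * ((∑ k ∈ s, c k / y k) * ∑ l ∈ s, c l / y l ^ 2) = ∑ k ∈ s, (2 * c k ^ 2 / y k ^ 3 +
      (∑ l ∈ s, 2 * c k * c l / ((l:ℚ) - k)) / y k ^ 2) := by
  have e0 : 2 * ((∑ k ∈ s, c k / y k) * ∑ l ∈ s, c l / y l ^ 2) =
      ∑ k ∈ s, ∑ l ∈ s, c k * c l * (1 / (y k * y l ^ 2) + 1 / (y l * y k ^ 2)) := by
    have : (∑ k ∈ s, c k / y k) * ∑ l ∈ s, c l / y l ^ 2 =
      ∑ k ∈ s, ∑ l ∈ s, c k * c l * (1 / (y k * y l ^ 2)) := by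
      rw [Finset.sum_mul_sum]
      apply Finset.sum_congr rfl; intro k hk
      apply Finset.sum_congr rfl; intro l hl
      rw [div_mul_div_comm, mul_one_div]
    rw [two_mul]
    nth_rw 2 [this]
    rw [Finset.sum_comm, this]
    rw [← Finset.sum_add_distrib]
    apply Finset.sum_congr rfl; intro k hk
    rw [← Finset.sum_add_distrib]
    apply Finset.sum_congr rfl; intro l hl
    ring
  have e1 : 2 * ((∑ k ∈ s, c k / y k) * ∑ l ∈ s, c l / y l ^ 2) =
      ∑ k ∈ s, ∑ l ∈ s, ((if k = l then 2 * c k ^ 2 / y k ^ 3 else 0)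
      + (c k * c l / ((l:ℚ) - k) / y k ^ 2 + c l * c k / ((k:ℚ) - l) / y l ^ 2)) := by
    rw [e0]
    apply Finset.sum_congr rfl; intro k hk
    apply Finset.sum_congr rfl; intro l hl
    have h1 := hy k hk
    have h2 := hy l hl
    by_cases h : k = l
    · subst h; simp; field_simp; norm_num
    · rw [if_neg h]
      have h3 : (l:ℚ) - k ≠ 0 := sub_ne_zero.2 (by exact_mod_cast Ne.symm h)
      have h4 : (k:ℚ) - l ≠ 0 := sub_ne_zero.2 (by exact_mod_cast h)
      have h5 := hd k hk l hl
      rw [← neg_sub (l:ℚ) k]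
      rw [← h5] at h3 ⊢
      field_simp
      ring
  rw [e1]
  simp only [Finset.sum_add_distrib]
  congr 1
  · apply Finset.sum_congr rfl; intro k hk
    rw [Finset.sum_ite_eq]; simp [hk]
  · rw [Finset.sum_comm (f := fun k l => c l * c k / ((k:ℚ) - l) / y l ^ 2), ← Finset.sum_add_distrib]
    apply Finset.sum_congr rfl; intro k hk
    rw [← Finset.sum_add_distrib, Finset.sum_div]
    apply Finset.sum_congr rfl; intro l hl
    ring

end generic

lemma sum_bb (n : ℕ) : ∑ k ∈ Finset.range (n + 1), bb n k = 0 := by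
  have h : ∑ k ∈ Finset.range (n + 1), bb n k = - ∑ k ∈ Finset.range (n + 1), bb n k := by
    simp only [bb]
    conv_rhs => rw [Finset.sum_comm]
    rw [← Finset.sum_neg_distrib]
    apply Finset.sum_congr rfl; intro k _
    rw [← Finset.sum_neg_distrib]
    apply Finset.sum_congr rfl; intro l _
    rw [← neg_sub (l:ℚ) k, div_neg]
    ring
  linarith

/-- The summands `w_{k,i}` (with `i` shifted by one). -/
def ww (n k i : ℕ) : ℚ := 128 * cc n k ^ 2 / (1 + 4 * ((k:ℚ) - (i + 1))) ^ 3 +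
  16 * bb n k / (1 + 4 * ((k:ℚ) - (i + 1))) ^ 2

lemma u_ne (k i : ℕ) : 1 + 4 * ((k:ℚ) - (i + 1)) ≠ 0 := by
  have := quarter_ne (-(i + 1)) k
  push_cast at this
  intro h; apply this; linarith

lemma ww_sum (n i : ℕ) (hi : i < n) : ∑ k ∈ Finset.range (n + 1), ww n k i = 0 := by
  have h := cube_identity (Finset.range (n + 1)) (cc n) (fun k => (1 + 4 * ((k:ℚ) - (i + 1))) / 4)
    (fun k _ => div_ne_zero (u_ne k i) (by norm_num)) (fun k _ l _ => by ring)
  have h0 : ∑ k ∈ Finset.range (n + 1), cc n k / ((1 + 4 * ((k:ℚ) - (i + 1))) / 4) = 0 := by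
    rw [← GG_zero n i hi, GG]
    apply Finset.sum_congr rfl; intro k _; congr 1; ring
  rw [h0, zero_mul, mul_zero] at h
  rw [h]
  apply Finset.sum_congr rfl; intro k _
  rw [ww, ← bb]
  have := u_ne k i
  field_simp
  ring

lemma GG_sq (n t : ℕ) : GG n t ^ 2 = ∑ k ∈ Finset.range (n + 1),
    (16 * cc n k ^ 2 * ((1 + 4 * ((k:ℚ) + t)) ^ 2)⁻¹ + 4 * bb n k * (1 + 4 * ((k:ℚ) + t))⁻¹) := by
  have hne : ∀ k : ℕ, (t:ℚ) + 1 / 4 + k ≠ 0 := fun k => by positivity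
  have h := sq_identity (Finset.range (n + 1)) (cc n) (fun k => (t:ℚ) + 1 / 4 + k)
    (fun k _ => hne k) (fun k _ l _ => by ring)
  rw [GG, h, ← Finset.sum_add_distrib]
  apply Finset.sum_congr rfl; intro k _
  rw [← bb]
  have h2 : (t:ℚ) + 1 / 4 + k = (1 + 4 * ((k:ℚ) + t)) / 4 := by ring
  rw [h2]
  have h1 : 1 + 4 * ((k:ℚ) + t) ≠ 0 := by positivity
  field_simp
  ring

lemma prod_succ_fac (n t : ℕ) : ∏ i ∈ Finset.range n, ((t:ℚ) + i + 1) = n.factorial * (t + n).choose n := by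
  induction n with
  | zero => simp
  | succ n ih =>
    rw [Finset.prod_range_succ, ih]
    have h := Nat.add_one_mul_choose_eq (t + n) n
    rw [Nat.factorial_succ]
    rw [show t + (n + 1) = t + n + 1 by ring]
    have h2 : ((t:ℚ) + n + 1) * ((t + n).choose n : ℚ) = ((t + n + 1).choose (n + 1) : ℚ) * (n + 1) := by
      exact_mod_cast h
    push_cast
    linear_combination (n.factorial : ℚ) * h2

lemma GG_sq' (n t : ℕ) : GG n t ^ 2 = (n.factorial : ℚ) ^ 2 * 16 ^ (n + 1) *
    (((t + n).choose n : ℚ) ^ 2 * ((∏ k ∈ Finset.range (n + 1), (1 + 4 * ((k : ℚ) + t))) ^ 2)⁻¹) := by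
  have hne : ∀ k : ℕ, (t:ℚ) + 1 / 4 + k ≠ 0 := fun k => by positivity
  have h := GG_prod n t (fun k _ => hne k)
  rw [prod_succ_fac] at h
  have e : ∏ k ∈ Finset.range (n + 1), (1 + 4 * ((k : ℚ) + t)) =
      4 ^ (n + 1) * ∏ k ∈ Finset.range (n + 1), ((t:ℚ) + 1 / 4 + k) := by
    rw [← Finset.card_range (n + 1), ← Finset.prod_const, Finset.card_range, ← Finset.prod_mul_distrib]
    apply Finset.prod_congr rfl; intro k _; ring
  have hP : ∏ k ∈ Finset.range (n + 1), ((t:ℚ) + 1 / 4 + k) ≠ 0 :=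
    Finset.prod_ne_zero_iff.2 fun k _ => hne k
  rw [e]
  rw [show (16:ℚ) = 4 ^ 2 by norm_num, ← pow_mul, mul_comm 2 (n + 1), pow_mul, mul_pow]
  set A := ∏ k ∈ Finset.range (n + 1), ((t:ℚ) + 1 / 4 + k)
  have h2 : GG n t = (n.factorial * (t + n).choose n) / A := by rw [h]; field_simp
  rw [h2]
  field_simp

end Zeta2


namespace Zeta2

open Filter Topology

lemma prod_erase_split (k m : ℕ) (f : ℕ → ℚ) : ∏ l ∈ (Finset.range (k + m + 1)).erase k, f l =
    (∏ i ∈ Finset.range k, f i) * ∏ j ∈ Finset.range m, f (k + 1 + j) := by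
  have h : (Finset.range (k + m + 1)).erase k = (Finset.range k).disjUnion
      (Finset.Ico (k + 1) (k + 1 + m)) (by
        rw [Finset.disjoint_left]; intro x; simp; omega) := by
    ext x; simp; omega
  rw [h, Finset.prod_disjUnion, Finset.prod_Ico_eq_prod_range]
  congr 2
  congr 1; omega

lemma cc_eq (k m : ℕ) : cc (k + m) k = (∏ i ∈ Finset.range k, (((i:ℚ) + 3 / 4 - k) / ((i:ℚ) - k))) *
    ∏ j ∈ Finset.range m, (((j:ℚ) + 3 / 4) / ((j:ℚ) + 1)) := by
  rw [cc, prod_erase_split, Finset.prod_range_add, Finset.prod_div_distrib, Finset.prod_div_distrib,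
    Finset.prod_inv_distrib, Finset.prod_inv_distrib]
  have e1 : ∏ x ∈ Finset.range m, (((k + x : ℕ) : ℚ) + 3 / 4 - k) = ∏ j ∈ Finset.range m, ((j:ℚ) + 3 / 4) := by
    apply Finset.prod_congr rfl; intro x _; push_cast; ring
  have e2 : ∏ x ∈ Finset.range m, (((k + 1 + x : ℕ) : ℚ) - k) = ∏ j ∈ Finset.range m, ((j:ℚ) + 1) := by
    apply Finset.prod_congr rfl; intro x _; push_cast; ring
  rw [e1, e2]
  ring

lemma abs_cc_le (n k : ℕ) (hk : k ≤ n) : |cc n k| ≤ 1 := by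
  obtain ⟨m, rfl⟩ := Nat.exists_eq_add_of_le hk
  rw [cc_eq, abs_mul, Finset.abs_prod, Finset.abs_prod]
  apply mul_le_one₀
  · apply Finset.prod_le_one
    · intro i _; exact abs_nonneg _
    · intro i hi
      have : (i:ℚ) + 1 ≤ k := by exact_mod_cast Finset.mem_range.1 hi
      rw [abs_div, abs_of_neg (by linarith), abs_of_neg (by linarith), div_le_one (by linarith)]
      linarith
  · positivity
  · apply Finset.prod_le_one
    · intro i _; exact abs_nonneg _
    · intro i hi
      rw [abs_of_nonneg (by positivity), div_le_one (by positivity)]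
      linarith

lemma abs_bb_le (n k : ℕ) (hk : k ≤ n) : |bb n k| ≤ 2 * (n + 1) := by
  rw [bb]
  refine (Finset.abs_sum_le_sum_abs _ _).trans ?_
  have : ∀ l ∈ Finset.range (n + 1), |2 * cc n k * cc n l / ((l:ℚ) - k)| ≤ 2 := by
    intro l hl
    have h1 := abs_cc_le n k hk
    have h2 := abs_cc_le n l (by simpa [Nat.lt_succ_iff] using hl)
    by_cases h : l = k
    · subst h; simp
    · have h3 : (1:ℚ) ≤ |(l:ℚ) - k| := by
        have : (1:ℤ) ≤ |(l:ℤ) - k| := Int.one_le_abs (sub_ne_zero.2 (by exact_mod_cast h))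
        exact_mod_cast this
      rw [abs_div, abs_mul, abs_mul, abs_two, div_le_iff₀ (by linarith)]
      have h4 : |cc n k| * |cc n l| ≤ 1 := mul_le_one₀ h1 (abs_nonneg _) h2
      nlinarith
  refine (Finset.sum_le_sum this).trans ?_
  simp; linarith

/-- The integer denominators. -/
def uu (k i : ℕ) : ℤ := 1 + 4 * ((k:ℤ) - (i + 1))

lemma uu_cast (k i : ℕ) : ((uu k i : ℤ) : ℚ) = 1 + 4 * ((k:ℚ) - (i + 1)) := by
  rw [uu]; push_cast; ring

lemma uu_ne (k i : ℕ) : uu k i ≠ 0 := by rw [uu]; omega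

lemma ww_eq (n k i : ℕ) : ww n k i = 128 * cc n k ^ 2 / (uu k i : ℚ) ^ 3 + 16 * bb n k / (uu k i : ℚ) ^ 2 := by
  rw [ww, uu_cast]

lemma abs_ww_le (n k i : ℕ) (hk : k ≤ n) : |ww n k i| ≤ 160 * (n + 1) := by
  have h1 := abs_cc_le n k hk
  have h2 := abs_bb_le n k hk
  have h3 : (1:ℚ) ≤ |(uu k i : ℚ)| := by
    have := Int.one_le_abs (uu_ne k i)
    exact_mod_cast this
  rw [ww_eq]
  refine (abs_add_le _ _).trans ?_
  have a1 : |128 * cc n k ^ 2 / (uu k i : ℚ) ^ 3| ≤ 128 := by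
    rw [abs_div, abs_mul, abs_pow, abs_pow]
    refine (div_le_self (by positivity) (one_le_pow₀ h3)).trans ?_
    have : |cc n k| ^ 2 ≤ 1 := pow_le_one₀ (abs_nonneg _) h1
    norm_num; linarith
  have a2 : |16 * bb n k / (uu k i : ℚ) ^ 2| ≤ 16 * (2 * ((n:ℚ) + 1)) := by
    rw [abs_div, abs_mul, abs_pow]
    refine (div_le_self (by positivity) (one_le_pow₀ h3)).trans ?_
    norm_num; linarith
  have : (0:ℚ) ≤ n := by positivity
  linarith

/-- The rational part of the linear form. -/
def rho (n : ℕ) : ℚ := ∑ i ∈ Finset.range n, ∑ k ∈ (Finset.range (n + 1)).filter (fun k => i + 1 ≤ k), ww n k i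

lemma abs_rho_le (n : ℕ) : |rho n| ≤ 160 * (n + 1) ^ 3 := by
  rw [rho]
  refine (Finset.abs_sum_le_sum_abs _ _).trans ?_
  have h1 : ∀ i ∈ Finset.range n, |∑ k ∈ (Finset.range (n + 1)).filter (fun k => i + 1 ≤ k), ww n k i| ≤
      (n + 1) * (160 * (n + 1)) := by
    intro i _
    refine (Finset.abs_sum_le_sum_abs _ _).trans ?_
    refine (Finset.sum_le_sum (g := fun _ => 160 * ((n:ℚ) + 1)) ?_).trans ?_
    · intro k hk
      exact abs_ww_le n k i (by simp at hk; omega)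
    · rw [Finset.sum_const, nsmul_eq_mul]
      gcongr
      have := Finset.card_filter_le (Finset.range (n + 1)) (fun k => i + 1 ≤ k)
      rw [Finset.card_range] at this
      exact_mod_cast this
  refine (Finset.sum_le_sum h1).trans ?_
  rw [Finset.sum_const, nsmul_eq_mul, Finset.card_range]
  have : (0:ℚ) ≤ n := by positivity
  nlinarith [mul_nonneg this this]

lemma fac_dvd (n : ℕ) (a : ℤ) : (n.factorial : ℤ) ∣ 2 ^ n * ∏ i ∈ Finset.range n, (4 * (i:ℤ) + a) := by
  obtain ⟨e, M, hM, hfac⟩ := Nat.exists_eq_two_pow_mul_odd n.factorial_ne_zero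
  have he : e ≤ n := by
    by_contra hc
    have h1 : 2 ^ (n + 1) ∣ n.factorial := by
      rw [hfac]; exact (pow_dvd_pow 2 (by omega)).mul_right _
    rcases Nat.eq_zero_or_pos n with rfl | hn
    · simp at h1
    have h2 := sub_one_mul_padicValNat_factorial_lt_of_ne_zero 2 hn.ne'
    have h3 := (padicValNat_dvd_iff_le (p := 2) n.factorial_ne_zero).1 h1
    omega
  have hMd : (M:ℤ) ∣ ∏ i ∈ Finset.range n, (4 * (i:ℤ) + a) := by
    have hcop : IsCoprime (4:ℤ) (M:ℤ) := by
      have : Nat.Coprime 4 M := by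
        have : Nat.Coprime (2 ^ 2) M := Nat.Coprime.pow_left _ (Nat.coprime_two_left.2 hM)
        simpa using this
      exact_mod_cast Nat.isCoprime_iff_coprime.2 this
    obtain ⟨x, y, hxy⟩ := hcop
    have h1 : (M:ℤ) ∣ ∏ i ∈ Finset.range n, (x * a + i) :=
      dvd_trans (show (M:ℤ) ∣ (n.factorial : ℤ) from ⟨2 ^ e, by rw [hfac]; push_cast; ring⟩)
        (Nat.factorial_coe_dvd_prod n (x * a))
    have h2 : (M:ℤ) ∣ ∏ i ∈ Finset.range n, (4 * (x * a + i)) := by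
      rw [Finset.prod_mul_distrib]; exact h1.mul_left _
    have h3 : ∏ i ∈ Finset.range n, (4 * (x * a + i)) ≡ ∏ i ∈ Finset.range n, (4 * (i:ℤ) + a) [ZMOD M] := by
      apply Int.ModEq.prod
      intro i _
      rw [Int.modEq_iff_dvd]
      exact ⟨y * a, by linear_combination (-a) * hxy⟩
    exact h3.dvd_iff.1 h2
  rw [hfac]
  push_cast
  exact mul_dvd_mul (pow_dvd_pow _ he) hMd

lemma prod_neg_fac (k : ℕ) : ∏ i ∈ Finset.range k, ((i:ℚ) - k) = (-1) ^ k * k.factorial := by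
  have h : ∏ i ∈ Finset.range k, ((i:ℚ) - k) = ∏ i ∈ Finset.range k, ((-1) * ((i:ℚ) + 1)) := by
    rw [← Finset.prod_range_reflect]
    apply Finset.prod_congr rfl
    intro i hi
    have := Finset.mem_range.1 hi
    rw [Nat.cast_sub (by omega), Nat.cast_sub (by omega)]
    push_cast; ring
  rw [h, Finset.prod_mul_distrib, Finset.prod_const, Finset.card_range, ← Finset.prod_range_add_one_eq_factorial]
  push_cast; rfl

lemma cc_int (n k : ℕ) (hk : k ≤ n) : ∃ z : ℤ, 8 ^ n * cc n k = z := by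
  obtain ⟨q, hq⟩ := fac_dvd n (3 - 4 * k)
  obtain ⟨m, rfl⟩ := Nat.exists_eq_add_of_le hk
  refine ⟨(-1) ^ k * (k + m).choose k * q, ?_⟩
  have h1 : (4:ℚ) ^ (k + m) * ∏ i ∈ Finset.range (k + m), ((i:ℚ) + 3 / 4 - k) =
      ∏ i ∈ Finset.range (k + m), (4 * (i:ℚ) + (3 - 4 * k)) := by
    conv_lhs => rw [← Finset.card_range (k + m), ← Finset.prod_const, Finset.card_range, ← Finset.prod_mul_distrib]
    apply Finset.prod_congr rfl; intro i _; ring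
  have h2 : (2:ℚ) ^ (k + m) * ∏ i ∈ Finset.range (k + m), (4 * (i:ℚ) + (3 - 4 * k)) =
      (k + m).factorial * q := by exact_mod_cast hq
  have h3 : ((k + m).choose k : ℚ) * k.factorial * m.factorial = (k + m).factorial := by
    have := Nat.choose_mul_factorial_mul_factorial (Nat.le_add_right k m)
    rw [Nat.add_sub_cancel_left] at this
    exact_mod_cast this
  have h4 : cc (k + m) k = (∏ i ∈ Finset.range (k + m), ((i:ℚ) + 3 / 4 - k)) *
      ((-1:ℚ) ^ k * k.factorial * m.factorial)⁻¹ := by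
    rw [cc, Finset.prod_inv_distrib, prod_erase_split, prod_neg_fac]
    congr 3
    rw [← Finset.prod_range_add_one_eq_factorial]
    push_cast
    apply Finset.prod_congr rfl; intro i _; ring
  have hk0 : (k.factorial : ℚ) ≠ 0 := by exact_mod_cast k.factorial_ne_zero
  have hm0 : (m.factorial : ℚ) ≠ 0 := by exact_mod_cast m.factorial_ne_zero
  have hs : ((-1:ℚ) ^ k) * (-1) ^ k = 1 := by rw [← mul_pow]; norm_num
  have hs0 : ((-1:ℚ) ^ k) ≠ 0 := by intro h; rw [h] at hs; simp at hs
  rw [h4, show (8:ℚ) = 2 * 4 by norm_num, mul_pow]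
  push_cast
  rw [← mul_assoc, mul_assoc ((2:ℚ) ^ _), h1, h2, ← h3, ← div_eq_mul_inv, div_eq_iff (mul_ne_zero (mul_ne_zero hs0 hk0) hm0)]
  linear_combination (-((k + m).choose k : ℚ) * k.factorial * m.factorial * q) * hs

lemma dvd_lcm {n j : ℕ} (h1 : 1 ≤ j) (h2 : j ≤ n) : j ∣ Nat.lcmUpto n := by
  rw [Nat.lcmUpto]
  exact Finset.dvd_lcm (f := id) (Finset.mem_Icc.2 ⟨h1, h2⟩)

lemma bb_int (n k : ℕ) (hk : k ≤ n) : ∃ z : ℤ, 64 ^ n * Nat.lcmUpto n * bb n k = z := by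
  choose c hc using fun l : ℕ => fun h : l ≤ n => cc_int n l h
  have : ∀ l ∈ Finset.range (n + 1), ∃ z : ℤ,
      64 ^ n * Nat.lcmUpto n * (2 * cc n k * cc n l / ((l:ℚ) - k)) = z := by
    intro l hl
    have hl : l ≤ n := by simp at hl; omega
    by_cases h : l = k
    · exact ⟨0, by subst h; simp⟩
    · have h3 : (l:ℤ) - k ≠ 0 := sub_ne_zero.2 (by exact_mod_cast h)
      have hd : ((l:ℤ) - k) ∣ (Nat.lcmUpto n : ℤ) := by
        rw [← Int.natAbs_dvd_natAbs, Int.natAbs_natCast]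
        exact dvd_lcm (by omega) (by omega)
      obtain ⟨e, he⟩ := hd
      have he' : (Nat.lcmUpto n : ℚ) = ((l:ℚ) - k) * e := by exact_mod_cast he
      have h3' : (l:ℚ) - k ≠ 0 := by exact_mod_cast h3
      refine ⟨2 * c k hk * c l hl * e, ?_⟩
      push_cast
      rw [← hc k hk, ← hc l hl, he', show (64:ℚ) = 8 * 8 by norm_num, mul_pow]
      field_simp
  choose! z hz using this
  refine ⟨∑ l ∈ Finset.range (n + 1), z l, ?_⟩
  rw [bb, Finset.mul_sum]
  push_cast
  exact Finset.sum_congr rfl hz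

lemma padic_d_div_u (p : ℕ) [hp : Fact p.Prime] (n : ℕ) (hn : n ≠ 0) (u : ℤ) (hu : u ≠ 0)
    (h : ¬ ((p ^ (p.log n + 1) : ℕ) : ℤ) ∣ u) : padicNorm p ((Nat.lcmUpto n : ℚ) / u) ≤ 1 := by
  obtain ⟨e, v, hv, huv⟩ := Nat.exists_eq_pow_mul_and_not_dvd (Int.natAbs_ne_zero.2 hu) p hp.out.ne_one
  have he : e ≤ p.log n := by
    by_contra hc
    apply h
    rw [← Int.natAbs_dvd_natAbs, Int.natAbs_natCast, huv]
    exact (pow_dvd_pow _ (by omega)).mul_right _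
  have hd : p ^ e ∣ Nat.lcmUpto n :=
    (pow_dvd_pow _ he).trans (dvd_lcm (Nat.one_le_pow _ _ hp.out.pos) (Nat.pow_log_le_self p hn))
  obtain ⟨d, hd⟩ := hd
  have hp0 : (p:ℚ) ^ e ≠ 0 := pow_ne_zero _ (by exact_mod_cast hp.out.ne_zero)
  have key : padicNorm p ((Nat.lcmUpto n : ℚ) / (u.natAbs : ℚ)) ≤ 1 := by
    rw [hd, huv]
    push_cast
    rw [mul_div_mul_left _ _ hp0, padicNorm.div, (padicNorm.nat_eq_one_iff (p := p) v).2 hv, div_one]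
    exact padicNorm.of_nat d
  rcases Int.natAbs_eq u with h1 | h1
  · have : (u:ℚ) = (u.natAbs : ℚ) := by
      have := congrArg (fun x : ℤ => (x:ℚ)) h1
      simpa using this
    rw [this]; exact key
  · have : (u:ℚ) = -(u.natAbs : ℚ) := by
      have := congrArg (fun x : ℤ => (x:ℚ)) h1
      simpa using this
    rw [this, div_neg, padicNorm.neg]; exact key

lemma padic_ww (p : ℕ) [hp : Fact p.Prime] (n k i : ℕ) (hn : n ≠ 0) (hk : k ≤ n)
    (h : ¬ ((p ^ (p.log n + 1) : ℕ) : ℤ) ∣ uu k i) :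
    padicNorm p (64 ^ n * (Nat.lcmUpto n : ℚ) ^ 3 * ww n k i) ≤ 1 := by
  have h1 := padic_d_div_u p n hn (uu k i) (uu_ne k i) h
  obtain ⟨c, hc⟩ := cc_int n k hk
  obtain ⟨b, hb⟩ := bb_int n k hk
  have hu : (uu k i : ℚ) ≠ 0 := by exact_mod_cast uu_ne k i
  set x := (Nat.lcmUpto n : ℚ) / (uu k i : ℚ) with hx
  have e : 64 ^ n * (Nat.lcmUpto n : ℚ) ^ 3 * ww n k i =
      ((128 * c ^ 2 : ℤ) : ℚ) * (x * x * x) + ((16 * b : ℤ) : ℚ) * (x * x) := by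
    push_cast
    rw [← hc, ← hb, ww_eq, hx, show (64:ℚ) = 8 * 8 by norm_num, mul_pow]
    field_simp
  rw [e]
  have h0 := padicNorm.nonneg (p := p) x
  have hx2 : padicNorm p (x * x) ≤ 1 := by
    rw [padicNorm.mul]; exact mul_le_one₀ h1 h0 h1
  have hx3 : padicNorm p (x * x * x) ≤ 1 := by
    rw [padicNorm.mul]; exact mul_le_one₀ hx2 h0 h1
  refine padicNorm.nonarchimedean.trans (max_le ?_ ?_)
  · rw [padicNorm.mul]; exact mul_le_one₀ (padicNorm.of_int _) (padicNorm.nonneg _) hx3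
  · rw [padicNorm.mul]; exact mul_le_one₀ (padicNorm.of_int _) (padicNorm.nonneg _) hx2

lemma bad_unique (p : ℕ) [hp : Fact p.Prime] (n k k' i : ℕ) (hk : k ≤ n) (hk' : k' ≤ n)
    (h : ((p ^ (p.log n + 1) : ℕ) : ℤ) ∣ uu k i) (h' : ((p ^ (p.log n + 1) : ℕ) : ℤ) ∣ uu k' i) : k = k' := by
  have h1 : ((p ^ (p.log n + 1) : ℕ) : ℤ) ∣ 4 * ((k:ℤ) - k') := by
    have e : 4 * ((k:ℤ) - k') = uu k i - uu k' i := by rw [uu, uu]; ring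
    rw [e]; exact dvd_sub h h'
  have hp2 : p ≠ 2 := by
    rintro rfl
    have : (2:ℤ) ∣ uu k i := dvd_trans ⟨((2 ^ (Nat.log 2 n) : ℕ) : ℤ), by push_cast; ring⟩ h
    rw [uu] at this
    omega
  have hc : IsCoprime ((p ^ (p.log n + 1) : ℕ) : ℤ) 4 := by
    have : Nat.Coprime (p ^ (p.log n + 1)) (2 ^ 2) :=
      Nat.Coprime.pow _ _ ((Nat.coprime_primes hp.out Nat.prime_two).2 hp2)
    exact_mod_cast Nat.isCoprime_iff_coprime.2 this
  have h2 := hc.dvd_of_dvd_mul_left h1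
  have h3 : n < p ^ (p.log n + 1) := Nat.lt_pow_succ_log_self hp.out.one_lt n
  have h4 := Int.eq_zero_of_abs_lt_dvd h2 (by rw [abs_lt]; constructor <;> omega)
  omega

lemma padic_V (p : ℕ) [hp : Fact p.Prime] (n i : ℕ) (hi : i < n) :
    padicNorm p (64 ^ n * (Nat.lcmUpto n : ℚ) ^ 3 *
      ∑ k ∈ (Finset.range (n + 1)).filter (fun k => i + 1 ≤ k), ww n k i) ≤ 1 := by
  have hn : n ≠ 0 := by omega
  by_cases hbad : ∃ k ∈ (Finset.range (n + 1)).filter (fun k => i + 1 ≤ k),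
      ((p ^ (p.log n + 1) : ℕ) : ℤ) ∣ uu k i
  · obtain ⟨k0, hk0, hd⟩ := hbad
    simp only [Finset.mem_filter, Finset.mem_range] at hk0
    have h0 := ww_sum n i hi
    rw [← Finset.sum_filter_add_sum_filter_not _ (fun k => i + 1 ≤ k)] at h0
    rw [eq_neg_of_add_eq_zero_left h0, mul_neg, padicNorm.neg, Finset.mul_sum]
    apply padicNorm.sum_le' _ zero_le_one
    intro k hk
    simp only [Finset.mem_filter, Finset.mem_range] at hk
    apply padic_ww p n k i hn (by omega)
    intro hc
    have := bad_unique p n k k0 i (by omega) (by omega) hc hd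
    omega
  · push Not at hbad
    rw [Finset.mul_sum]
    apply padicNorm.sum_le' _ zero_le_one
    intro k hk
    have hk2 := hk
    simp only [Finset.mem_filter, Finset.mem_range] at hk2
    exact padic_ww p n k i hn (by omega) (hbad k hk)

lemma int_of_padic (x : ℚ) (h : ∀ p : ℕ, ∀ _ : Fact p.Prime, padicNorm p x ≤ 1) : ∃ z : ℤ, x = z := by
  by_cases hx : x.den = 1
  · exact ⟨x.num, ((Rat.den_eq_one_iff x).1 hx).symm⟩
  exfalso
  obtain ⟨p, hp, hd⟩ := Nat.exists_prime_and_dvd hx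
  have hf : Fact p.Prime := ⟨hp⟩
  have h1 := h p hf
  have hnum : ¬ (p:ℤ) ∣ x.num := by
    intro hc
    have h2 : p ∣ x.num.natAbs := Int.natCast_dvd.1 hc
    have := Nat.dvd_gcd h2 hd
    rw [x.reduced.gcd_eq_one] at this
    exact hp.one_lt.ne' (Nat.dvd_one.1 this)
  have h3 : padicNorm p x = padicNorm p x.num / padicNorm p x.den := by
    rw [← padicNorm.div, Rat.num_div_den]
  rw [h3, (padicNorm.int_eq_one_iff (p := p) x.num).2 hnum] at h1
  have h4 := (padicNorm.nat_lt_one_iff (p := p) x.den).2 hd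
  have h5 : 0 < padicNorm p x.den := lt_of_le_of_ne (padicNorm.nonneg _)
    (padicNorm.nonzero (by exact_mod_cast x.den_ne_zero)).symm
  rw [div_le_one h5] at h1
  linarith

lemma rho_int (n : ℕ) : ∃ z : ℤ, 64 ^ n * (Nat.lcmUpto n : ℚ) ^ 3 * rho n = z := by
  apply int_of_padic
  intro p hp
  rw [rho, Finset.mul_sum]
  apply padicNorm.sum_le' _ zero_le_one
  intro i hi
  exact padic_V p n i (Finset.mem_range.1 hi)

lemma sq_int (n : ℕ) : ∃ z : ℤ, 64 ^ n * ∑ k ∈ Finset.range (n + 1), cc n k ^ 2 = z := by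
  have : ∀ k ∈ Finset.range (n + 1), ∃ z : ℤ, 64 ^ n * cc n k ^ 2 = z := by
    intro k hk
    obtain ⟨c, hc⟩ := cc_int n k (by simp at hk; omega)
    refine ⟨c ^ 2, ?_⟩
    push_cast
    rw [← hc, show (64:ℚ) = 8 * 8 by norm_num, mul_pow]; ring
  choose! z hz using this
  refine ⟨∑ k ∈ Finset.range (n + 1), z k, ?_⟩
  rw [Finset.mul_sum]
  push_cast
  exact Finset.sum_congr rfl hz

lemma sq_le (n : ℕ) : |∑ k ∈ Finset.range (n + 1), cc n k ^ 2| ≤ n + 1 := by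
  refine (Finset.abs_sum_le_sum_abs _ _).trans ?_
  refine (Finset.sum_le_sum (g := fun _ => (1:ℚ)) ?_).trans (by simp)
  intro k hk
  rw [abs_pow]
  exact pow_le_one₀ (abs_nonneg _) (abs_cc_le n k (by simp at hk; omega))

lemma fac_two_dvd (a : ℕ) : 2 ^ (2 ^ a - 1) ∣ (2 ^ a).factorial := by
  induction a with
  | zero => simp
  | succ a ih =>
    have h1 := Nat.add_choose_mul_factorial_mul_factorial (2 ^ a) (2 ^ a)
    obtain ⟨m, hm⟩ : ∃ m, 2 ^ a = m + 1 := ⟨2 ^ a - 1, by have := Nat.one_le_two_pow (n := a); omega⟩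
    have h2 : 2 ∣ (2 ^ a + 2 ^ a).choose (2 ^ a) := by
      have := Nat.two_dvd_centralBinom_succ m
      rw [Nat.centralBinom, ← hm, two_mul] at this
      exact this
    have h3 := mul_dvd_mul (mul_dvd_mul h2 ih) ih
    rw [h1] at h3
    have e : 2 ^ (2 ^ (a + 1) - 1) = 2 * 2 ^ (2 ^ a - 1) * 2 ^ (2 ^ a - 1) := by
      rw [← pow_succ', ← pow_add]
      congr 1
      rw [pow_succ]; omega
    rw [e, pow_succ, mul_two]
    exact h3

lemma norm_fac (a n : ℕ) (hn : n = 2 ^ a - 1) : 2 ^ n * ‖(n.factorial : ℚ_[2])‖ ≤ 2 ^ a := by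
  have h1 : n + 1 = 2 ^ a := by have := Nat.one_le_two_pow (n := a); omega
  have h2 := fac_two_dvd a
  rw [← hn, ← h1, Nat.factorial_succ] at h2
  have h3 : ‖(((n + 1) * n.factorial : ℕ) : ℚ_[2])‖ ≤ ((2:ℝ) ^ n)⁻¹ := by
    have : (2:ℤ) ^ n ∣ (((n + 1) * n.factorial : ℕ) : ℤ) := by exact_mod_cast h2
    exact_mod_cast norm_le_of_dvd this
  rw [h1] at h3
  push_cast at h3
  rw [norm_mul, norm_two_pow] at h3
  rw [inv_mul_le_iff₀ (by positivity), ← div_eq_mul_inv, le_div_iff₀ (by positivity)] at h3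
  linarith

end Zeta2


namespace Zeta2

open Filter Topology

lemma rho_eq (n : ℕ) : rho n = ∑ k ∈ Finset.range (n + 1), ∑ j ∈ Finset.range k,
    (128 * cc n k ^ 2 * ((1 + 4 * (j:ℚ)) ^ 3)⁻¹ + 16 * bb n k * ((1 + 4 * (j:ℚ)) ^ 2)⁻¹) := by
  have h1 : rho n = ∑ k ∈ Finset.range (n + 1), ∑ i ∈ Finset.range k, ww n k i := by
    rw [rho]
    apply Finset.sum_comm'
    intro i k
    simp only [Finset.mem_filter, Finset.mem_range]
    omega
  rw [h1]
  apply Finset.sum_congr rfl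
  intro k _
  rw [← Finset.sum_range_reflect]
  apply Finset.sum_congr rfl
  intro j hj
  have hj := Finset.mem_range.1 hj
  have e : (k:ℚ) - (((k - 1 - j : ℕ) : ℚ) + 1) = j := by
    rw [Nat.cast_sub (by omega), Nat.cast_sub (by omega)]
    push_cast; ring
  rw [ww, e, div_eq_mul_inv, div_eq_mul_inv]

lemma GG_sq_cast (n t : ℕ) : ((GG n t : ℚ) : ℚ_[2]) ^ 2 =
    ∑ k ∈ Finset.range (n + 1), (16 * (cc n k : ℚ_[2]) ^ 2 * ((1 + 4 * ((k:ℚ_[2]) + t)) ^ 2)⁻¹ +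
      4 * (bb n k : ℚ_[2]) * (1 + 4 * ((k:ℚ_[2]) + t))⁻¹) := by
  have := congrArg (fun x : ℚ => (x : ℚ_[2])) (GG_sq n t)
  push_cast at this
  exact this

lemma GG_sq_cast' (n t : ℕ) : ((GG n t : ℚ) : ℚ_[2]) ^ 2 =
    (n.factorial : ℚ_[2]) ^ 2 * 16 ^ (n + 1) * (((t + n).choose n : ℚ_[2]) ^ 2 *
      ((∏ k ∈ Finset.range (n + 1), (1 + 4 * ((k:ℚ_[2]) + t))) ^ 2)⁻¹) := by
  have := congrArg (fun x : ℚ => (x : ℚ_[2])) (GG_sq' n t)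
  push_cast at this
  exact this

lemma S_GG (n N : ℕ) : S N (fun t => ((GG n t : ℚ) : ℚ_[2]) ^ 2) =
    ∑ k ∈ Finset.range (n + 1), (16 * (cc n k : ℚ_[2]) ^ 2 * S N (fun t => ((1 + 4 * ((k:ℚ_[2]) + t)) ^ 2)⁻¹) +
      4 * (bb n k : ℚ_[2]) * (S N (fun t => (1 + 4 * ((k:ℚ_[2]) + t))⁻¹) - S N (fun t => (1 + 4 * (t:ℚ_[2]))⁻¹))) := by
  simp only [GG_sq_cast]
  rw [S_sum]
  have hb : ∑ k ∈ Finset.range (n + 1), (bb n k : ℚ_[2]) = 0 := by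
    have := congrArg (fun x : ℚ => (x : ℚ_[2])) (sum_bb n)
    push_cast at this
    exact this
  have h : ∀ k, S N (fun t => 16 * (cc n k : ℚ_[2]) ^ 2 * ((1 + 4 * ((k:ℚ_[2]) + t)) ^ 2)⁻¹ +
      4 * (bb n k : ℚ_[2]) * (1 + 4 * ((k:ℚ_[2]) + t))⁻¹) =
      16 * (cc n k : ℚ_[2]) ^ 2 * S N (fun t => ((1 + 4 * ((k:ℚ_[2]) + t)) ^ 2)⁻¹) +
      4 * (bb n k : ℚ_[2]) * S N (fun t => (1 + 4 * ((k:ℚ_[2]) + t))⁻¹) := by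
    intro k
    rw [← S_mul, ← S_mul]
    simp only [S]
    rw [← add_div, ← Finset.sum_add_distrib]
  rw [Finset.sum_congr rfl fun k _ => h k]
  simp only [mul_sub, ← add_sub_assoc]
  rw [Finset.sum_sub_distrib _ _, ← Finset.sum_mul, ← Finset.mul_sum, hb]
  simp

lemma tendsto_GG (η : ℚ_[2])
    (h : Tendsto (fun N => S N (fun t => ((1 + 4 * (t : ℚ_[2])) ^ 2)⁻¹)) atTop (𝓝 (4 * η))) (n : ℕ) :
    Tendsto (fun N => S N (fun t => ((GG n t : ℚ) : ℚ_[2]) ^ 2)) atTop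
      (𝓝 (64 * ((∑ k ∈ Finset.range (n + 1), cc n k ^ 2 : ℚ) : ℚ_[2]) * η - (rho n : ℚ_[2]))) := by
  simp only [S_GG]
  refine tlim (tendsto_finsetSum _ fun k _ =>
    ((tendsto_shift_two k (4 * η) h).const_mul (16 * (cc n k : ℚ_[2]) ^ 2)).add
      ((tendsto_shift_one k).const_mul (4 * (bb n k : ℚ_[2])))) ?_
  rw [rho_eq]
  push_cast
  rw [Finset.mul_sum, Finset.sum_mul, ← Finset.sum_sub_distrib]
  apply Finset.sum_congr rfl
  intro k _
  rw [Finset.sum_add_distrib, ← Finset.mul_sum, ← Finset.mul_sum]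
  ring

lemma norm_lim (η : ℚ_[2])
    (h : Tendsto (fun N => S N (fun t => ((1 + 4 * (t : ℚ_[2])) ^ 2)⁻¹)) atTop (𝓝 (4 * η))) (a n : ℕ)
    (ha : 1 ≤ a) (hn : n = 2 ^ a - 1) :
    ‖64 * ((∑ k ∈ Finset.range (n + 1), cc n k ^ 2 : ℚ) : ℚ_[2]) * η - (rho n : ℚ_[2])‖ =
      ‖(n.factorial : ℚ_[2])‖ ^ 2 * (16 ^ (n + 1))⁻¹ * 2 ^ a := by
  have h1 := (tendsto_GG η h n).norm
  refine tendsto_nhds_unique h1 ?_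
  refine tendsto_const_nhds.congr' ?_
  filter_upwards [eventually_ge_atTop a] with N hN
  simp only [GG_sq_cast']
  rw [S_mul, norm_mul, exact_norm a N ha hN n hn, norm_mul, norm_pow, norm_pow]
  congr 2
  rw [show (16:ℚ_[2]) = 2 ^ 4 by norm_num, norm_two_pow, inv_pow]
  norm_num

lemma irrational (η : ℚ_[2])
    (h : Tendsto (fun N => S N (fun t => ((1 + 4 * (t : ℚ_[2])) ^ 2)⁻¹)) atTop (𝓝 (4 * η))) (r s : ℤ)
    (hs : s ≠ 0) : η ≠ r / s := by
  intro he
  have hs2 : (s:ℚ_[2]) ≠ 0 := by exact_mod_cast hs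
  have hη : (s:ℚ_[2]) * η = r := by rw [he]; field_simp
  have hbig := lcm_growth (224 * (|(r:ℝ)| + |(s:ℝ)|)) 6
  have ht : Tendsto (fun a : ℕ => 2 ^ a - 1) atTop atTop := by
    apply tendsto_atTop_mono (f := fun a : ℕ => a) _ tendsto_id
    intro a
    have := Nat.lt_two_pow_self (n := a)
    omega
  obtain ⟨a, hcon, ha⟩ := ((ht.eventually hbig).and (eventually_ge_atTop 1)).exists
  obtain ⟨n, hn⟩ : ∃ n, n = 2 ^ a - 1 := ⟨_, rfl⟩
  rw [← hn] at hcon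
  have hna : ((n:ℝ) + 1) = 2 ^ a := by
    have h1 : n + 1 = 2 ^ a := by have := Nat.one_le_two_pow (n := a); omega
    exact_mod_cast h1
  obtain ⟨z1, hz1⟩ := sq_int n
  obtain ⟨z2, hz2⟩ := rho_int n
  have hL := norm_lim η h a n ha hn
  set σ : ℚ := ∑ k ∈ Finset.range (n + 1), cc n k ^ 2 with hσ
  set d : ℕ := Nat.lcmUpto n with hd
  have hf := norm_fac a n hn
  have hsq := sq_le n
  have hrho := abs_rho_le n
  rw [← hσ] at hsq
  obtain ⟨I, hI⟩ : ∃ I : ℤ, I = 64 * (d:ℤ) ^ 3 * z1 * r - s * z2 := ⟨_, rfl⟩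
  have hIq : (I:ℚ) = 64 ^ n * (d:ℚ) ^ 3 * (64 * σ * r - s * rho n) := by
    rw [hI]; push_cast; rw [← hz1, ← hz2]; ring
  have hIp : (I:ℚ_[2]) = 64 ^ n * (d:ℚ_[2]) ^ 3 * s * (64 * (σ : ℚ_[2]) * η - (rho n : ℚ_[2])) := by
    have := congrArg (fun x : ℚ => (x : ℚ_[2])) hIq
    push_cast at this
    rw [this, ← hη]; ring
  have hfpos : 0 < ‖(n.factorial : ℚ_[2])‖ := norm_pos_iff.2 (by exact_mod_cast n.factorial_ne_zero)
  have hd0 : d ≠ 0 := by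
    rw [hd, Nat.lcmUpto]
    intro h0
    rw [Finset.lcm_eq_zero_iff] at h0
    simp at h0
  have h64 : ‖(64:ℚ_[2]) ^ n‖ = (64 ^ n)⁻¹ := by
    rw [norm_pow, show (64:ℚ_[2]) = 2 ^ 6 by norm_num, norm_two_pow, inv_pow]; norm_num
  have hnormI : ‖(I:ℚ_[2])‖ = (64 ^ n)⁻¹ * ‖(d:ℚ_[2])‖ ^ 3 * ‖(s:ℚ_[2])‖ *
      (‖(n.factorial : ℚ_[2])‖ ^ 2 * (16 ^ (n + 1))⁻¹ * 2 ^ a) := by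
    rw [hIp, norm_mul, hL, norm_mul, norm_mul, h64, norm_pow]
  have hI0 : I ≠ 0 := by
    have hdp : 0 < ‖(d:ℚ_[2])‖ := norm_pos_iff.2 (by exact_mod_cast hd0)
    have hsp : 0 < ‖(s:ℚ_[2])‖ := norm_pos_iff.2 hs2
    have : 0 < ‖(I:ℚ_[2])‖ := by rw [hnormI]; positivity
    intro h0
    rw [h0] at this
    simp at this
  have hone := one_le_norm_mul_abs I hI0
  have hup : ‖(I:ℚ_[2])‖ ≤ (64 ^ n)⁻¹ * (64 ^ n)⁻¹ * ((n:ℝ) + 1) ^ 3 := by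
    have hd1 : ‖(d:ℚ_[2])‖ ^ 3 ≤ 1 := pow_le_one₀ (norm_nonneg _) (by exact_mod_cast Padic.norm_int_le_one (p := 2) (d:ℤ))
    have hs1 : ‖(s:ℚ_[2])‖ ≤ 1 := Padic.norm_int_le_one s
    have h3 : ‖(n.factorial : ℚ_[2])‖ ^ 2 ≤ ((4:ℝ) ^ n)⁻¹ * ((n:ℝ) + 1) ^ 2 := by
      have := pow_le_pow_left₀ (by positivity) hf 2
      rw [← hna, mul_pow, ← pow_mul, mul_comm n 2, pow_mul] at this
      rw [← div_eq_inv_mul, le_div_iff₀ (by positivity)]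
      norm_num at this
      linarith
    rw [hnormI, ← hna]
    calc (64 ^ n)⁻¹ * ‖(d:ℚ_[2])‖ ^ 3 * ‖(s:ℚ_[2])‖ *
      (‖(n.factorial : ℚ_[2])‖ ^ 2 * (16 ^ (n + 1))⁻¹ * ((n:ℝ) + 1))
        ≤ (64 ^ n)⁻¹ * 1 * 1 * (((4:ℝ) ^ n)⁻¹ * ((n:ℝ) + 1) ^ 2 * (16 ^ n)⁻¹ * ((n:ℝ) + 1)) := by
          gcongr
          · norm_num
          · omega
      _ = (64 ^ n)⁻¹ * (64 ^ n)⁻¹ * ((n:ℝ) + 1) ^ 3 := by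
          rw [show (64:ℝ) = 4 * 16 by norm_num, mul_pow]
          field_simp
  have habs : |(I:ℝ)| ≤ 64 ^ n * (d:ℝ) ^ 3 * (224 * (|(r:ℝ)| + |(s:ℝ)|) * ((n:ℝ) + 1) ^ 3) := by
    have hq : |(I:ℚ)| ≤ 64 ^ n * (d:ℚ) ^ 3 * (224 * (|(r:ℚ)| + |(s:ℚ)|) * ((n:ℚ) + 1) ^ 3) := by
      rw [hIq, abs_mul, abs_of_nonneg (by positivity : (0:ℚ) ≤ 64 ^ n * (d:ℚ) ^ 3)]
      gcongr
      refine (abs_sub _ _).trans ?_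
      rw [abs_mul, abs_mul, abs_mul]
      have hn0 : (0:ℚ) ≤ n := by positivity
      have p3 : (n:ℚ) + 1 ≤ ((n:ℚ) + 1) ^ 3 := le_self_pow₀ (by linarith) (by norm_num)
      have e1 : |(64:ℚ)| * |σ| * |(r:ℚ)| ≤ 64 * ((n:ℚ) + 1) ^ 3 * |(r:ℚ)| := by
        gcongr
        · norm_num
        · exact hsq.trans p3
      have e2 : |(s:ℚ)| * |rho n| ≤ |(s:ℚ)| * (160 * ((n:ℚ) + 1) ^ 3) := by gcongr
      have e3 : 0 ≤ ((n:ℚ) + 1) ^ 3 * |(r:ℚ)| := by positivity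
      have e4 : 0 ≤ ((n:ℚ) + 1) ^ 3 * |(s:ℚ)| := by positivity
      nlinarith
    exact_mod_cast hq
  have hfin : (1:ℝ) ≤ ((64 ^ n)⁻¹ * (64 ^ n)⁻¹ * ((n:ℝ) + 1) ^ 3) *
      (64 ^ n * (d:ℝ) ^ 3 * (224 * (|(r:ℝ)| + |(s:ℝ)|) * ((n:ℝ) + 1) ^ 3)) :=
    hone.trans (mul_le_mul hup habs (abs_nonneg _) (by positivity))
  have e : ((64 ^ n)⁻¹ * (64 ^ n)⁻¹ * ((n:ℝ) + 1) ^ 3) *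
      (64 ^ n * (d:ℝ) ^ 3 * (224 * (|(r:ℝ)| + |(s:ℝ)|) * ((n:ℝ) + 1) ^ 3)) =
      (224 * (|(r:ℝ)| + |(s:ℝ)|) * ((n:ℝ) + 1) ^ 6 * (d:ℝ) ^ 3) / 64 ^ n := by
    field_simp
  rw [e, le_div_iff₀ (by positivity)] at hfin
  linarith

end Zeta2

theorem stmt_5 (k : ℕ) (hk : 1 ≤ k) (η : ℚ_[2])
    (hη : ∃ K : ℕ → ℕ, (∀ j, 0 < K j) ∧
      Filter.Tendsto (fun j => (K j : ℝ)) Filter.atTop Filter.atTop ∧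
      Filter.Tendsto (fun j => ‖(K j : ℚ_[2]) + (k : ℚ_[2])‖) Filter.atTop (nhds 0) ∧
      Filter.Tendsto
        (fun j => ((-((1 - (2 : ℚ) ^ (2 * K j - 1)) * bernoulli (2 * K j) / (2 * K j)) : ℚ) : ℚ_[2]))
        Filter.atTop (nhds η)) :
    ∀ ε : ℝ, 0 < ε → ∃ P Q : ℕ → ℤ, (∀ n, Q n ≠ 0) ∧
      Filter.Tendsto (fun n => |Q n|) Filter.atTop Filter.atTop ∧
      ∀ᶠ n in Filter.atTop,
        0 < ‖η - (P n : ℚ_[2]) / (Q n : ℚ_[2])‖ ∧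
        ‖η - (P n : ℚ_[2]) / (Q n : ℚ_[2])‖ ≤
          ((max |P n| |Q n| : ℤ) : ℝ) ^
            (-(12 * Real.log 2 / (6 * Real.log 2 + 2 * k + 1) - ε)) := by
  intro ε hε
  apply Zeta2.Good.seq
  have l1 := Real.log_two_lt_d9
  have l2 := Real.log_two_gt_d9
  have hk' : (1:ℝ) ≤ k := by exact_mod_cast hk
  have hpos : 0 < 6 * Real.log 2 + 2 * k + 1 := by linarith
  have hθ2 : 12 * Real.log 2 / (6 * Real.log 2 + 2 * k + 1) - ε < 2 := by
    have : 12 * Real.log 2 / (6 * Real.log 2 + 2 * k + 1) < 2 := by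
      rw [div_lt_iff₀ hpos]; linarith
    linarith
  by_cases hirr : ∀ r s : ℤ, s ≠ 0 → η ≠ r / s
  · exact Zeta2.good_irrat η hirr _ hθ2
  · rcases Nat.lt_or_ge k 2 with h2 | h2
    · exfalso
      apply hirr
      obtain rfl : k = 1 := by omega
      obtain ⟨K, hK, _, h3, h4⟩ := hη
      exact Zeta2.irrational η (Zeta2.tendsto_S_inv η K hK (by simpa using h3) h4)
    · push Not at hirr
      obtain ⟨r, s, hs, rfl⟩ := hirr
      apply Zeta2.good_rat r s hs
      have hk2 : (2:ℝ) ≤ k := by exact_mod_cast h2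
      have : 12 * Real.log 2 / (6 * Real.log 2 + 2 * k + 1) < 1 := by
        rw [div_lt_iff₀ hpos]; linarith
      linarith
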